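/- arXiv:1312.6816 — 2 statements merged into one kernel-verified Lean document; each statement's English description precedes it below -/
import Mathlib

section
/- The monodromy matrix entries D and B satisfy the exchange relation: for all λ₁, λ₂ ∈ ℂ, b(λ₁−λ₂) D(λ₁) B(λ₂) = a(λ₁−λ₂) B(λ₂) D(λ₁) − c(λ₁−λ₂) B(λ₁) D(λ₂) as operators on (ℂ²)^{⊗L}. -/
noncomputable section

/-- `a(λ) = sinh(λ + γ)` -/
def af (γ lam : ℂ) : ℂ := Complex.sinh (lam + γ)

/-- `b(λ) = sinh(λ)` -/
def bf (lam : ℂ) : ℂ := Complex.sinh lam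

/-- `c(λ) = sinh(γ)` (a constant function of `λ`). -/
def cf (γ : ℂ) (_lam : ℂ) : ℂ := Complex.sinh γ

/-- The six-vertex R-matrix on `ℂ² ⊗ ℂ²`, in the ordered basis
`(e₁⊗e₁, e₁⊗e₂, e₂⊗e₁, e₂⊗e₂)` encoded by pairs `(i, j) : Fin 2 × Fin 2`. -/
def Rmat (γ lam : ℂ) : Matrix (Fin 2 × Fin 2) (Fin 2 × Fin 2) ℂ :=
  fun p q =>
    if p = q then (if p.1 = p.2 then af γ lam else bf lam)
    else if p.1 = q.2 ∧ p.2 = q.1 then cf γ lam else 0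

/-- `R_{ai}(λ)` on `ℂ² ⊗ (ℂ²)^{⊗L}`: `R(λ)` on the auxiliary factor and the
`i`-th quantum factor, identity elsewhere.  A vector of the space is indexed by
a pair `(auxiliary index, quantum indices)`. -/
def Rai (γ : ℂ) {L : ℕ} (lam : ℂ) (i : Fin L) :
    Matrix (Fin 2 × (Fin L → Fin 2)) (Fin 2 × (Fin L → Fin 2)) ℂ :=
  fun p q =>
    Rmat γ lam (p.1, p.2 i) (q.1, q.2 i) *
      (if ∀ k, k ≠ i → p.2 k = q.2 k then 1 else 0)

/-- The monodromy matrix `T(λ) = R_{a1}(λ−μ₁) R_{a2}(λ−μ₂) ⋯ R_{aL}(λ−μ_L)`. -/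
def Tmat (γ : ℂ) {L : ℕ} (μ : Fin L → ℂ) (lam : ℂ) :
    Matrix (Fin 2 × (Fin L → Fin 2)) (Fin 2 × (Fin L → Fin 2)) ℂ :=
  (List.ofFn fun i : Fin L => Rai γ (lam - μ i) i).prod

/-- `A(λ)`: the (1,1) block of `T(λ)` with respect to the auxiliary factor. -/
def Aop (γ : ℂ) {L : ℕ} (μ : Fin L → ℂ) (lam : ℂ) :
    Matrix (Fin L → Fin 2) (Fin L → Fin 2) ℂ :=
  fun p q => Tmat γ μ lam (0, p) (0, q)

/-- `B(λ)`: the (1,2) block of `T(λ)` with respect to the auxiliary factor. -/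
def Bop (γ : ℂ) {L : ℕ} (μ : Fin L → ℂ) (lam : ℂ) :
    Matrix (Fin L → Fin 2) (Fin L → Fin 2) ℂ :=
  fun p q => Tmat γ μ lam (0, p) (1, q)

/-- `C(λ)`: the (2,1) block of `T(λ)` with respect to the auxiliary factor. -/
def Cop (γ : ℂ) {L : ℕ} (μ : Fin L → ℂ) (lam : ℂ) :
    Matrix (Fin L → Fin 2) (Fin L → Fin 2) ℂ :=
  fun p q => Tmat γ μ lam (1, p) (0, q)

/-- `D(λ)`: the (2,2) block of `T(λ)` with respect to the auxiliary factor. -/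
def Dop (γ : ℂ) {L : ℕ} (μ : Fin L → ℂ) (lam : ℂ) :
    Matrix (Fin L → Fin 2) (Fin L → Fin 2) ℂ :=
  fun p q => Tmat γ μ lam (1, p) (1, q)

/-- The vector `|0⟩ = e₁^{⊗L}`. -/
def v0 {L : ℕ} : (Fin L → Fin 2) → ℂ :=
  fun p => if p = (fun _ => 0) then 1 else 0

/-- The vector `|0̄⟩ = e₂^{⊗L}`. -/
def v0bar {L : ℕ} : (Fin L → Fin 2) → ℂ :=
  fun p => if p = (fun _ => 1) then 1 else 0

/-- The site embedding: a 2×2 matrix acting on the `i`-th quantum factor. -/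
def siteHom {L : ℕ} (i : Fin L) :
    Matrix (Fin 2) (Fin 2) ℂ →+* Matrix (Fin L → Fin 2) (Fin L → Fin 2) ℂ where
  toFun m := Matrix.of fun p q => m (p i) (q i) * (if ∀ k, k ≠ i → p k = q k then 1 else 0)
  map_one' := by
    ext p q
    simp only [Matrix.one_apply, Matrix.of_apply]
    by_cases h : p = q
    · subst h; simp
    · rw [if_neg h]
      by_cases h1 : p i = q i
      · have : ¬ ∀ k, k ≠ i → p k = q k := by
          intro h2; apply h; funext k
          by_cases hk : k = i
          · subst hk; exact h1
          · exact h2 k hk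
        rw [if_neg this]; simp
      · simp [h1]
  map_zero' := by ext p q; simp
  map_add' m n := by ext p q; simp only [Matrix.of_apply, Matrix.add_apply, add_mul]
  map_mul' m n := by
    ext p q
    simp only [Matrix.mul_apply, Matrix.of_apply]
    have hinj : Function.Injective (fun x : Fin 2 => Function.update p i x) := by
      intro x y hxy
      have := congrFun hxy i
      simpa using this
    rw [← Finset.sum_subset (Finset.subset_univ (Finset.univ.image
      (fun x : Fin 2 => Function.update p i x)))]
    · rw [Finset.sum_image (fun x _ y _ h => hinj h), Finset.sum_mul]
      refine Finset.sum_congr rfl fun x _ => ?_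
      have e1 : ∀ k, k ≠ i → p k = Function.update p i x k := by
        intro k hk; simp [hk]
      have e2 : (∀ k, k ≠ i → Function.update p i x k = q k) ↔ (∀ k, k ≠ i → p k = q k) := by
        refine forall_congr' fun k => forall_congr' fun hk => ?_
        simp [hk]
      rw [if_pos e1]
      simp only [e2, Function.update_self]
      ring
    · intro r _ hr
      have : ¬ ∀ k, k ≠ i → p k = r k := by
        intro h; apply hr
        refine Finset.mem_image.2 ⟨r i, Finset.mem_univ _, ?_⟩
        funext k
        by_cases hk : k = i
        · subst hk; simp
        · simp [hk, h k hk]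
      rw [if_neg this]; simp

lemma siteHom_apply {L : ℕ} (i : Fin L) (m : Matrix (Fin 2) (Fin 2) ℂ) (p q : Fin L → Fin 2) :
    siteHom i m p q = m (p i) (q i) * (if ∀ k, k ≠ i → p k = q k then 1 else 0) := rfl

lemma siteHom_mul_apply {L : ℕ} {i j : Fin L} (hij : i ≠ j) (m n : Matrix (Fin 2) (Fin 2) ℂ)
    (p q : Fin L → Fin 2) :
    (siteHom i m * siteHom j n) p q = m (p i) (q i) * n (p j) (q j) *
      (if ∀ k, k ≠ i → k ≠ j → p k = q k then 1 else 0) := by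
  rw [Matrix.mul_apply, Finset.sum_eq_single (Function.update p i (q i))]
  · simp only [siteHom_apply]
    have e1 : ∀ k, k ≠ i → p k = Function.update p i (q i) k := by
      intro k hk; simp [hk]
    have e2 : (∀ k, k ≠ j → Function.update p i (q i) k = q k) ↔
        (∀ k, k ≠ i → k ≠ j → p k = q k) := by
      refine forall_congr' fun k => ?_
      by_cases hk : k = i
      · subst hk; simp
      · simp [hk]
    rw [if_pos e1]
    simp only [e2, Function.update_self, Function.update_of_ne hij.symm]
    ring
  · intro r _ hr
    simp only [siteHom_apply]
    by_cases h1 : ∀ k, k ≠ i → p k = r k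
    · have : ¬ ∀ k, k ≠ j → r k = q k := by
        intro h; apply hr
        funext k
        by_cases hk : k = i
        · subst hk; simp [h k hij]
        · simp [hk, h1 k hk]
      rw [if_neg this]; simp
    · rw [if_neg h1]; simp
  · simp

lemma siteHom_comm {L : ℕ} {i j : Fin L} (hij : i ≠ j) (m n : Matrix (Fin 2) (Fin 2) ℂ) :
    Commute (siteHom i m) (siteHom j n) := by
  ext p q
  rw [siteHom_mul_apply hij, siteHom_mul_apply hij.symm]
  have : (∀ k, k ≠ i → k ≠ j → p k = q k) ↔ (∀ k, k ≠ j → k ≠ i → p k = q k) :=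
    forall_congr' fun k => ⟨fun h a b => h b a, fun h a b => h b a⟩
  simp only [this]
  ring

section embed
variable {S : Type*} [Ring S]

/-- Embedding into the first auxiliary space. -/
def emb1 : Matrix (Fin 2) (Fin 2) S →* Matrix (Fin 2 × Fin 2) (Fin 2 × Fin 2) S where
  toFun M := Matrix.of fun p q => if p.2 = q.2 then M p.1 q.1 else 0
  map_one' := by
    ext ⟨i, j⟩ ⟨k, l⟩
    simp only [Matrix.one_apply, Matrix.of_apply, Prod.mk.injEq]
    by_cases h : j = l <;> by_cases h' : i = k <;> simp [h, h']
  map_mul' M N := by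
    ext ⟨i, j⟩ ⟨k, l⟩
    simp only [Matrix.mul_apply, Matrix.of_apply, Fintype.sum_prod_type]
    by_cases h : j = l <;> simp [h]

/-- Embedding into the second auxiliary space. -/
def emb2 : Matrix (Fin 2) (Fin 2) S →* Matrix (Fin 2 × Fin 2) (Fin 2 × Fin 2) S where
  toFun M := Matrix.of fun p q => if p.1 = q.1 then M p.2 q.2 else 0
  map_one' := by
    ext ⟨i, j⟩ ⟨k, l⟩
    simp only [Matrix.one_apply, Matrix.of_apply, Prod.mk.injEq]
    by_cases h : j = l <;> by_cases h' : i = k <;> simp [h, h']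
  map_mul' M N := by
    ext ⟨i, j⟩ ⟨k, l⟩
    simp only [Matrix.mul_apply, Matrix.of_apply, Fintype.sum_prod_type_right]
    by_cases h : i = k <;> simp [h]

lemma emb1_apply (M : Matrix (Fin 2) (Fin 2) S) (p q : Fin 2 × Fin 2) :
    emb1 M p q = if p.2 = q.2 then M p.1 q.1 else 0 := rfl

lemma emb2_apply (M : Matrix (Fin 2) (Fin 2) S) (p q : Fin 2 × Fin 2) :
    emb2 M p q = if p.1 = q.1 then M p.2 q.2 else 0 := rfl

lemma emb1_mul_emb2 (M N : Matrix (Fin 2) (Fin 2) S) (i j k l : Fin 2) :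
    (emb1 M * emb2 N) (i, j) (k, l) = M i k * N j l := by
  fin_cases i <;> fin_cases j <;> fin_cases k <;> fin_cases l <;>
    simp [Matrix.mul_apply, Fintype.sum_prod_type, emb1_apply, emb2_apply]

lemma emb2_mul_emb1 (M N : Matrix (Fin 2) (Fin 2) S) (i j k l : Fin 2) :
    (emb2 N * emb1 M) (i, j) (k, l) = N j l * M i k := by
  fin_cases i <;> fin_cases j <;> fin_cases k <;> fin_cases l <;>
    simp [Matrix.mul_apply, Fintype.sum_prod_type, emb1_apply, emb2_apply]

end embed

/-- Train argument. -/
lemma train {M ι : Type*} [Monoid M] (X : M) (a b : ι → M)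
    (h : ∀ i, X * (a i * b i) = b i * a i * X)
    (hc : ∀ i j, i ≠ j → Commute (a i) (b j)) (l : List ι) (hl : l.Nodup) :
    X * ((l.map a).prod * (l.map b).prod) = (l.map b).prod * (l.map a).prod * X := by
  induction l with
  | nil => simp
  | cons i l ih =>
    have hl' := List.nodup_cons.1 hl
    have c1 : Commute (l.map a).prod (b i) := by
      apply Commute.list_prod_left
      intro x hx
      obtain ⟨j, hj, rfl⟩ := List.mem_map.1 hx
      exact hc j i (fun e => hl'.1 (e ▸ hj))
    have c2 : Commute (a i) (l.map b).prod := by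
      apply Commute.list_prod_right
      intro x hx
      obtain ⟨j, hj, rfl⟩ := List.mem_map.1 hx
      exact hc i j (fun e => hl'.1 (e ▸ hj))
    simp only [List.map_cons, List.prod_cons]
    calc X * (a i * (l.map a).prod * (b i * (l.map b).prod))
        = X * (a i * ((l.map a).prod * b i) * (l.map b).prod) := by simp only [mul_assoc]
      _ = (X * (a i * b i)) * ((l.map a).prod * (l.map b).prod) := by
          rw [c1.eq]; simp only [mul_assoc]
      _ = b i * a i * (X * ((l.map a).prod * (l.map b).prod)) := by
          rw [h i]; simp only [mul_assoc]
      _ = b i * (a i * (l.map b).prod) * (l.map a).prod * X := by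
          rw [ih hl'.2]; simp only [mul_assoc]
      _ = _ := by rw [c2.eq]; simp only [mul_assoc]

/-- The local L-operator. -/
def Lloc (γ lam : ℂ) : Matrix (Fin 2) (Fin 2) (Matrix (Fin 2) (Fin 2) ℂ) :=
  fun α β s t => Rmat γ lam (α, s) (β, t)

/-- The R-matrix acting on the two auxiliary spaces. -/
def Raux (Q : Type*) [Fintype Q] [DecidableEq Q] (γ lam : ℂ) :
    Matrix (Fin 2 × Fin 2) (Fin 2 × Fin 2) (Matrix Q Q ℂ) :=
  fun p q => Matrix.scalar Q (Rmat γ lam p q)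

lemma Rmat_apply (γ lam : ℂ) (i j k l : Fin 2) : Rmat γ lam (i, j) (k, l) =
    if i = k ∧ j = l then (if i = j then af γ lam else bf lam)
    else if i = l ∧ j = k then cf γ lam else 0 := by
  simp [Rmat]

lemma ybe_local (γ x y : ℂ) :
    Raux (Fin 2) γ (x - y) * (emb1 (Lloc γ x) * emb2 (Lloc γ y)) =
      emb2 (Lloc γ y) * emb1 (Lloc γ x) * Raux (Fin 2) γ (x - y) := by
  have H1 : af γ (x - y) * bf x = af γ x * bf (x - y) + cf γ 0 * bf y := by
    obtain ⟨u, rfl⟩ : ∃ u, x = u + y := ⟨x - y, by ring⟩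
    simp only [add_sub_cancel_right, af, bf, cf, Complex.sinh_add, Complex.cosh_add]
    linear_combination Complex.sinh γ * Complex.sinh y * Complex.cosh_sq u
  have H2 : af γ (x - y) * af γ y = bf y * bf (x - y) + cf γ 0 * af γ x := by
    obtain ⟨u, rfl⟩ : ∃ u, x = u + y := ⟨x - y, by ring⟩
    simp only [add_sub_cancel_right, af, bf, cf, Complex.sinh_add, Complex.cosh_add]
    linear_combination Complex.sinh u * Complex.sinh y * Complex.cosh_sq γ
  have H3 : bf x * af γ y = bf y * af γ x + cf γ 0 * bf (x - y) := by
    obtain ⟨u, rfl⟩ : ∃ u, x = u + y := ⟨x - y, by ring⟩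
    simp only [add_sub_cancel_right, af, bf, cf, Complex.sinh_add, Complex.cosh_add]
    linear_combination Complex.sinh u * Complex.sinh γ * Complex.cosh_sq y
  refine Matrix.ext fun ⟨i, j⟩ ⟨k, l⟩ => Matrix.ext fun s t => ?_
  rw [Matrix.mul_apply, Matrix.mul_apply]
  simp only [Fintype.sum_prod_type, Fin.sum_univ_two, emb1_mul_emb2, emb2_mul_emb1, Raux,
    Matrix.scalar_apply, Matrix.add_apply, Matrix.diagonal_mul, Matrix.mul_diagonal]
  simp only [Matrix.mul_apply, Fin.sum_univ_two, Lloc, Rmat_apply]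
  have hc : ∀ z, cf γ z = cf γ 0 := fun z => rfl
  rw [hc (x - y), hc x, hc y]
  generalize af γ (x - y) = a1 at H1 H2 H3 ⊢
  generalize bf (x - y) = b1 at H1 H2 H3 ⊢
  generalize af γ x = a2 at H1 H2 H3 ⊢
  generalize bf x = b2 at H1 H2 H3 ⊢
  generalize af γ y = a3 at H1 H2 H3 ⊢
  generalize bf y = b3 at H1 H2 H3 ⊢
  generalize cf γ 0 = c at H1 H2 H3 ⊢
  fin_cases i <;> fin_cases j <;> fin_cases k <;> fin_cases l <;> fin_cases s <;> fin_cases t <;>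
    simp <;> first
    | ring1
    | linear_combination c * H1
    | linear_combination -c * H1
    | linear_combination c * H2
    | linear_combination -c * H2
    | linear_combination c * H3
    | linear_combination -c * H3

lemma ybe_site (γ x y : ℂ) {L : ℕ} (i : Fin L) :
    Raux (Fin L → Fin 2) γ (x - y) *
        (emb1 ((Lloc γ x).map (siteHom i)) * emb2 ((Lloc γ y).map (siteHom i))) =
      emb2 ((Lloc γ y).map (siteHom i)) * emb1 ((Lloc γ x).map (siteHom i)) *
        Raux (Fin L → Fin 2) γ (x - y) := by
  have h := congrArg (fun M => M.map (siteHom i)) (ybe_local γ x y)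
  have hR : (Raux (Fin 2) γ (x - y)).map (siteHom i) = Raux (Fin L → Fin 2) γ (x - y) := by
    ext p q s t
    have h1 := congrFun (congrFun (map_one (siteHom i)) s) t
    simp only [Raux, Matrix.map_apply, Matrix.scalar_apply, siteHom_apply,
      Matrix.diagonal_apply, Matrix.one_apply] at h1 ⊢
    split_ifs at h1 ⊢ <;> simp_all
  have h1 : ∀ M : Matrix (Fin 2) (Fin 2) (Matrix (Fin 2) (Fin 2) ℂ),
      (emb1 M).map (siteHom i) = emb1 (M.map (siteHom i)) := by
    intro M; refine Matrix.ext fun p q => ?_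
    simp only [emb1_apply, Matrix.map_apply]
    split_ifs <;> simp
  have h2 : ∀ M : Matrix (Fin 2) (Fin 2) (Matrix (Fin 2) (Fin 2) ℂ),
      (emb2 M).map (siteHom i) = emb2 (M.map (siteHom i)) := by
    intro M; refine Matrix.ext fun p q => ?_
    simp only [emb2_apply, Matrix.map_apply]
    split_ifs <;> simp
  simpa only [Matrix.map_mul, hR, h1, h2] using h

/-- The monodromy matrix as a 2×2 matrix of operators. -/
def Tblk (γ : ℂ) {L : ℕ} (μ : Fin L → ℂ) (lam : ℂ) :
    Matrix (Fin 2) (Fin 2) (Matrix (Fin L → Fin 2) (Fin L → Fin 2) ℂ) :=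
  ((List.finRange L).map fun i => (Lloc γ (lam - μ i)).map (siteHom i)).prod

lemma Tblk_eq (γ : ℂ) {L : ℕ} (μ : Fin L → ℂ) (lam : ℂ) (α β : Fin 2) (p q : Fin L → Fin 2) :
    Tblk γ μ lam α β p q = Tmat γ μ lam (α, p) (β, q) := by
  have h : Matrix.compRingEquiv (Fin 2) (Fin L → Fin 2) ℂ (Tblk γ μ lam) = Tmat γ μ lam := by
    rw [Tblk, Tmat, map_list_prod, List.map_map, List.ofFn_eq_map]
    rfl
  rw [← h]
  rfl

lemma rtt (γ : ℂ) {L : ℕ} (μ : Fin L → ℂ) (l1 l2 : ℂ) :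
    Raux (Fin L → Fin 2) γ (l1 - l2) * (emb1 (Tblk γ μ l1) * emb2 (Tblk γ μ l2)) =
      emb2 (Tblk γ μ l2) * emb1 (Tblk γ μ l1) * Raux (Fin L → Fin 2) γ (l1 - l2) := by
  have := train (Raux (Fin L → Fin 2) γ (l1 - l2))
    (fun i => emb1 ((Lloc γ (l1 - μ i)).map (siteHom i)))
    (fun i => emb2 ((Lloc γ (l2 - μ i)).map (siteHom i)))
    (fun i => by simpa using ybe_site γ (l1 - μ i) (l2 - μ i) i)
    (fun i j hij => by
      refine Matrix.ext fun ⟨a, b⟩ ⟨c, d⟩ => ?_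
      rw [emb1_mul_emb2, emb2_mul_emb1]
      exact (siteHom_comm hij _ _).eq)
    (List.finRange L) (List.nodup_finRange L)
  simpa only [Tblk, map_list_prod, List.map_map, Function.comp_def] using this

/-- Exchange relation between `D` and `B`:
`b(λ₁−λ₂) D(λ₁) B(λ₂) = a(λ₁−λ₂) B(λ₂) D(λ₁) − c(λ₁−λ₂) B(λ₁) D(λ₂)`. -/
theorem six_vertex_DB_exchange (γ : ℂ) (L : ℕ) (hL : 1 ≤ L) (μ : Fin L → ℂ)
    (l1 l2 : ℂ) :
    bf (l1 - l2) • (Dop γ μ l1 * Bop γ μ l2) =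
      af γ (l1 - l2) • (Bop γ μ l2 * Dop γ μ l1) -
        cf γ (l1 - l2) • (Bop γ μ l1 * Dop γ μ l2) := by
  have hB : ∀ l, Bop γ μ l = Tblk γ μ l 0 1 := fun l => by ext p q; exact (Tblk_eq ..).symm
  have hD : ∀ l, Dop γ μ l = Tblk γ μ l 1 1 := fun l => by ext p q; exact (Tblk_eq ..).symm
  have h := congrFun (congrFun (rtt γ μ l1 l2) (1, 0)) (1, 1)
  rw [Matrix.mul_apply, Matrix.mul_apply] at h
  simp only [Fintype.sum_prod_type, Fin.sum_univ_two, emb1_mul_emb2, emb2_mul_emb1, Raux,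
    ← hB, ← hD] at h
  have e : ∀ (r : ℂ) (M : Matrix (Fin L → Fin 2) (Fin L → Fin 2) ℂ),
      M * Matrix.scalar _ r = r • M := by
    intro r M; ext p q; simp [mul_comm]
  have e' : ∀ (r : ℂ) (M : Matrix (Fin L → Fin 2) (Fin L → Fin 2) ℂ),
      Matrix.scalar _ r * M = r • M := by
    intro r M; ext p q; simp
  simp only [e, e'] at h
  simp [Rmat] at h
  rw [← h]
  abel

end
end

section
/- Commutation rule for the dynamical creation operators: for all λ₁, λ₂, θ ∈ ℂ such that all theta-function denominators occurring are nonzero, ℬ(λ₁, θ) ℬ(λ₂, θ+γ) = ℬ(λ₂, θ) ℬ(λ₁, θ+γ) as operators on (ℂ²)^{⊗L}. -/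
noncomputable section

/-- `f(λ) = Θ₁(iλ, τ)/2`, where
`Θ₁(z, τ) = 2 ∑_{n=0}^{∞} (−1)ⁿ e^{iπτ(n+1/2)²} sin((2n+1)z)` is the Jacobi
theta function `θ₁`. -/
def thetaf (τ lam : ℂ) : ℂ :=
  ∑' n : ℕ,
    (-1) ^ n * Complex.exp ((Real.pi : ℂ) * Complex.I * τ * ((n : ℂ) + 1 / 2) ^ 2) *
      Complex.sin ((2 * (n : ℂ) + 1) * (Complex.I * lam))

/-- The elliptic dynamical R-matrix `R(λ, θ)` on `ℂ² ⊗ ℂ²`, in the ordered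
basis `(e₁⊗e₁, e₁⊗e₂, e₂⊗e₁, e₂⊗e₂)` encoded by pairs in `Fin 2 × Fin 2`. -/
def Rdyn (τ γ lam θ : ℂ) : Matrix (Fin 2 × Fin 2) (Fin 2 × Fin 2) ℂ :=
  fun p q =>
    if p = q then
      (if p.1 = p.2 then thetaf τ (lam + γ)
       else if p.1 = 0 then thetaf τ lam * thetaf τ (θ - γ) / thetaf τ θ
       else thetaf τ lam * thetaf τ (θ + γ) / thetaf τ θ)
    else if p.1 = q.2 ∧ p.2 = q.1 then
      (if p.1 = 0 then thetaf τ γ * thetaf τ (θ - lam) / thetaf τ θ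
       else thetaf τ γ * thetaf τ (θ + lam) / thetaf τ θ)
    else 0

/-- The `h`-eigenvalue of the basis vector `e_s` of `ℂ²`: `ε₁ = 1, ε₂ = −1`. -/
def eps (s : Fin 2) : ℂ := if s = 0 then 1 else -1

/-- `R_{ai}(λ, θ − γ ∑_{k>i} h_k)` on `ℂ² ⊗ (ℂ²)^{⊗L}`: it acts as
`R(λ, θ − γ s)` on the auxiliary factor and the `i`-th quantum factor, on each
joint `h`-eigenvector of the quantum factors `k > i` with eigenvalue sum `s`,
and as the identity on the remaining factors. -/
def RaiDyn (τ γ : ℂ) {L : ℕ} (lam θ : ℂ) (i : Fin L) :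
    Matrix (Fin 2 × (Fin L → Fin 2)) (Fin 2 × (Fin L → Fin 2)) ℂ :=
  fun p q =>
    Rdyn τ γ lam (θ - γ * ∑ k ∈ Finset.univ.filter (fun k => i < k), eps (q.2 k))
      (p.1, p.2 i) (q.1, q.2 i) *
      (if ∀ k, k ≠ i → p.2 k = q.2 k then 1 else 0)

/-- The dynamical monodromy matrix
`𝒯(λ, θ) = R_{a1}(λ−μ₁, θ−γ∑_{k>1}h_k) ⋯ R_{aL}(λ−μ_L, θ)`. -/
def Tdyn (τ γ : ℂ) {L : ℕ} (μ : Fin L → ℂ) (lam θ : ℂ) :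
    Matrix (Fin 2 × (Fin L → Fin 2)) (Fin 2 × (Fin L → Fin 2)) ℂ :=
  (List.ofFn fun i : Fin L => RaiDyn τ γ (lam - μ i) θ i).prod

/-- `𝒜(λ, θ)`: the (1,1) block of `𝒯(λ, θ)` with respect to the auxiliary
factor. -/
def Adyn (τ γ : ℂ) {L : ℕ} (μ : Fin L → ℂ) (lam θ : ℂ) :
    Matrix (Fin L → Fin 2) (Fin L → Fin 2) ℂ :=
  fun p q => Tdyn τ γ μ lam θ (0, p) (0, q)

/-- `ℬ(λ, θ)`: the (1,2) block of `𝒯(λ, θ)` with respect to the auxiliary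
factor. -/
def Bdyn (τ γ : ℂ) {L : ℕ} (μ : Fin L → ℂ) (lam θ : ℂ) :
    Matrix (Fin L → Fin 2) (Fin L → Fin 2) ℂ :=
  fun p q => Tdyn τ γ μ lam θ (0, p) (1, q)

open Complex in
def thT (τ l : ℂ) (n : ℤ) : ℂ :=
  (-1) ^ n * cexp (Real.pi * I * τ * ((n : ℂ) + 1 / 2) ^ 2 - (2 * n + 1) * l)

open Complex in
def thG (τ x : ℂ) (s : ℤ) : ℂ :=
  cexp (Real.pi * I * τ * (s : ℂ) ^ 2 / 2 - 2 * s * x)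

open Complex in
lemma thT_eq (τ l : ℂ) (n : ℤ) :
    thT τ l n = cexp (Real.pi * I * τ / 4 - l) *
      jacobiTheta₂_term n (1 / 2 + τ / 2 + I * l / Real.pi) τ := by
  have hpi : (Real.pi : ℂ) ≠ 0 := by exact_mod_cast Real.pi_ne_zero
  have h1 : ((-1 : ℂ)) ^ n = cexp (n * (Real.pi * I)) := by
    rw [Complex.exp_int_mul, Complex.exp_pi_mul_I]
  rw [thT, jacobiTheta₂_term, h1, ← Complex.exp_add, ← Complex.exp_add]
  congr 1
  field_simp
  ring_nf
  simp only [Complex.I_sq]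
  ring

open Complex in
lemma thG_eq (τ x : ℂ) (s : ℤ) :
    thG τ x s = jacobiTheta₂_term s (I * x / Real.pi) (τ / 2) := by
  have hpi : (Real.pi : ℂ) ≠ 0 := by exact_mod_cast Real.pi_ne_zero
  rw [thG, jacobiTheta₂_term]
  congr 1
  field_simp
  ring_nf
  simp only [Complex.I_sq]
  ring

lemma thT_summable {τ : ℂ} (hτ : 0 < τ.im) (l : ℂ) : Summable (thT τ l) := by
  have : thT τ l = fun n => _ := funext (thT_eq τ l)
  rw [this]
  exact ((summable_jacobiTheta₂_term_iff _ _).2 hτ).mul_left _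

lemma thG_summable {τ : ℂ} (hτ : 0 < τ.im) (x : ℂ) : Summable (thG τ x) := by
  have : thG τ x = fun n => _ := funext (thG_eq τ x)
  rw [this]
  refine (summable_jacobiTheta₂_term_iff _ _).2 ?_
  simpa using hτ

open Complex in
lemma thetaf_eq {τ : ℂ} (hτ : 0 < τ.im) (l : ℂ) :
    thetaf τ l = (1 / (2 * I)) * ∑' n : ℤ, thT τ l n := by
  have hs := thT_summable hτ l
  have s1 : Summable fun n : ℕ => thT τ l n := hs.comp_injective Nat.cast_injective
  have s2 : Summable fun n : ℕ => thT τ l (-((n : ℤ) + 1)) :=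
    hs.comp_injective (i := fun n : ℕ => -((n : ℤ) + 1)) (fun a b h => by simpa using h)
  rw [tsum_of_nat_of_neg_add_one s1 s2, ← Summable.tsum_add s1 s2, thetaf, ← tsum_mul_left]
  congr 1
  ext n
  have e1 : ((-1 : ℂ)) ^ (-((n : ℤ) + 1)) = -(-1) ^ n := by
    rw [zpow_neg, ← inv_zpow, show ((-1 : ℂ))⁻¹ = -1 by norm_num, zpow_add₀ (by norm_num)]
    simp
  have e2 : cexp (Real.pi * I * τ * ((((n : ℤ)) : ℂ) + 1 / 2) ^ 2 - (2 * ((n : ℤ) : ℂ) + 1) * l)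
      = cexp (Real.pi * I * τ * ((n : ℂ) + 1 / 2) ^ 2) *
        cexp ((2 * (n : ℂ) + 1) * (I * l) * I) := by
    rw [← Complex.exp_add]
    congr 1
    push_cast
    ring_nf
    simp only [Complex.I_sq]
    ring
  have e3 : cexp (Real.pi * I * τ * (((-((n : ℤ) + 1) : ℤ) : ℂ) + 1 / 2) ^ 2
        - (2 * ((-((n : ℤ) + 1) : ℤ) : ℂ) + 1) * l)
      = cexp (Real.pi * I * τ * ((n : ℂ) + 1 / 2) ^ 2) *
        cexp (-((2 * (n : ℂ) + 1) * (I * l)) * I) := by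
    rw [← Complex.exp_add]
    congr 1
    push_cast
    ring_nf
    simp only [Complex.I_sq]
    ring
  rw [thT, thT, e1, e2, e3, Complex.sin, zpow_natCast]
  field_simp
  simp only [Complex.I_sq]
  ring

def thE (τ x : ℂ) (s : ℤ) : ℂ := if Even s then thG τ x s else 0
def thO (τ x : ℂ) (s : ℤ) : ℂ := if Even s then 0 else thG τ x s

lemma thE_summable {τ : ℂ} (hτ : 0 < τ.im) (x : ℂ) : Summable (fun s => ‖thE τ x s‖) := by
  refine (thG_summable hτ x).norm.of_nonneg_of_le (fun _ => norm_nonneg _) (fun s => ?_)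
  unfold thE; split_ifs <;> simp

lemma thO_summable {τ : ℂ} (hτ : 0 < τ.im) (x : ℂ) : Summable (fun s => ‖thO τ x s‖) := by
  refine (thG_summable hτ x).norm.of_nonneg_of_le (fun _ => norm_nonneg _) (fun s => ?_)
  unfold thO; split_ifs <;> simp

open Complex in
lemma thT_mul (τ x y : ℂ) (n m : ℤ) :
    thT τ (x + y) n * thT τ (x - y) m =
      thO τ x (n + m + 1) * thE τ y (n - m) - thE τ x (n + m + 1) * thO τ y (n - m) := by
  have e : thT τ (x + y) n * thT τ (x - y) m =
      (-1) ^ (n + m) * (thG τ x (n + m + 1) * thG τ y (n - m)) := by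
    rw [thT, thT, thG, thG, zpow_add₀ (by norm_num), ← Complex.exp_add]
    rw [mul_mul_mul_comm, ← Complex.exp_add]
    congr 2
    push_cast
    ring
  rw [e]
  unfold thO thE
  by_cases h : Even (n + m)
  · have h1 : ¬ Even (n + m + 1) := by grind
    have h2 : Even (n - m) := by grind
    simp [h1, h2, h.neg_one_zpow]
  · have h1 : Even (n + m + 1) := by grind
    have h2 : ¬ Even (n - m) := by grind
    simp [h1, h2, (Int.not_even_iff_odd.1 h).neg_one_zpow]

lemma thetaf_mul {τ : ℂ} (hτ : 0 < τ.im) (x y : ℂ) :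
    thetaf τ (x + y) * thetaf τ (x - y) =
      (-1 / 4) * ((∑' s, thO τ x s) * (∑' s, thE τ y s)
        - (∑' s, thE τ x s) * (∑' s, thO τ y s)) := by
  have a1 := summable_mul_of_summable_norm (thO_summable hτ x) (thE_summable hτ y)
  have a2 := summable_mul_of_summable_norm (thE_summable hτ x) (thO_summable hτ y)
  rw [thetaf_eq hτ, thetaf_eq hτ, mul_mul_mul_comm,
    tsum_mul_tsum_of_summable_norm (thT_summable hτ _).norm (thT_summable hτ _).norm,
    tsum_mul_tsum_of_summable_norm (thO_summable hτ _) (thE_summable hτ _),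
    tsum_mul_tsum_of_summable_norm (thE_summable hτ _) (thO_summable hτ _),
    ← Summable.tsum_sub a1 a2]
  have hinj : Function.Injective (fun p : ℤ × ℤ => (p.1 + p.2 + 1, p.1 - p.2)) := by
    rintro ⟨a, b⟩ ⟨c, d⟩ h
    simp only [Prod.mk.injEq] at h ⊢
    omega
  rw [← hinj.tsum_eq (f := fun z : ℤ × ℤ => thO τ x z.1 * thE τ y z.2 - thE τ x z.1 * thO τ y z.2)]
  · have : (1 / (2 * Complex.I)) * (1 / (2 * Complex.I)) = -1 / 4 := by
      field_simp
      simp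
      try norm_num
    rw [this]
    congr 1
    exact tsum_congr fun p => thT_mul τ x y p.1 p.2
  · rintro ⟨s, d⟩ h
    by_contra hr
    apply h
    have hpar : Even s ↔ Even d := by
      by_contra hne
      apply hr
      refine ⟨((s + d - 1) / 2, (s - d - 1) / 2), ?_⟩
      simp only [Prod.mk.injEq]
      grind
    simp only [thO, thE]
    by_cases hs : Even s
    · simp [hs, hpar.1 hs]
    · simp [hs, mt hpar.2 hs]

lemma thetaf_three {τ : ℂ} (hτ : 0 < τ.im) (x y z w : ℂ) :
    thetaf τ (x + y) * thetaf τ (x - y) * (thetaf τ (z + w) * thetaf τ (z - w))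
      - thetaf τ (x + z) * thetaf τ (x - z) * (thetaf τ (y + w) * thetaf τ (y - w))
      + thetaf τ (x + w) * thetaf τ (x - w) * (thetaf τ (y + z) * thetaf τ (y - z)) = 0 := by
  simp only [thetaf_mul hτ]
  ring

lemma thetaf_neg (τ x : ℂ) : thetaf τ (-x) = -thetaf τ x := by
  unfold thetaf
  rw [← tsum_neg]
  congr 1
  ext n
  rw [mul_neg, mul_neg, Complex.sin_neg, mul_neg]

lemma thetaf_differentiable {τ : ℂ} (hτ : 0 < τ.im) : Differentiable ℂ (thetaf τ) := by
  have : thetaf τ = fun l => (1 / (2 * Complex.I)) * (Complex.exp (Real.pi * Complex.I * τ / 4 - l) *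
      jacobiTheta₂ (1 / 2 + τ / 2 + Complex.I * l / Real.pi) τ) := by
    ext l
    rw [thetaf_eq hτ, jacobiTheta₂, tsum_congr fun n => thT_eq τ l n, tsum_mul_left]
  rw [this]
  intro l
  have h1 := differentiableAt_jacobiTheta₂_fst (1 / 2 + τ / 2 + Complex.I * l / Real.pi) hτ
  have h2 : DifferentiableAt ℂ (fun l : ℂ => 1 / 2 + τ / 2 + Complex.I * l / Real.pi) l := by
    fun_prop
  have h3 := DifferentiableAt.comp l h1 h2
  have h4 : DifferentiableAt ℂ (fun l : ℂ => Complex.exp (Real.pi * Complex.I * τ / 4 - l)) l := by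
    fun_prop
  exact (h4.mul h3).const_mul _

lemma thetaf_dense {τ : ℂ} (hτ : 0 < τ.im) {x₀ : ℂ} (h : thetaf τ x₀ ≠ 0) (c : ℂ) :
    Dense {l : ℂ | thetaf τ (l - c) ≠ 0} := by
  have hd : Differentiable ℂ (fun l => thetaf τ (l - c)) := 
    (thetaf_differentiable hτ).comp (differentiable_id.sub_const c)
  have ha : AnalyticOnNhd ℂ (fun l => thetaf τ (l - c)) Set.univ :=
    hd.differentiableOn.analyticOnNhd isOpen_univ
  intro z
  by_contra hz
  rw [mem_closure_iff_frequently, Filter.not_frequently] at hz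
  have := ha.eqOn_zero_of_preconnected_of_eventuallyEq_zero isPreconnected_univ (Set.mem_univ z)
    (by filter_upwards [hz] with l hl; simpa using hl)
  have h2 := this (Set.mem_univ (x₀ + c))
  simp at h2
  exact h h2
set_option linter.unusedVariables false

/-- Weierstrass three-term relation. -/
def ThreeTerm (f : ℂ → ℂ) : Prop :=
  ∀ x y z w, f (x + y) * f (x - y) * (f (z + w) * f (z - w))
      - f (x + z) * f (x - z) * (f (y + w) * f (y - w))
      + f (x + w) * f (x - w) * (f (y + z) * f (y - z)) = 0

lemma dy_000000 (f : ℂ → ℂ) (hodd : ∀ z, f (-z) = -f z) (h3 : ThreeTerm f)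
    (u v x g : ℂ) (h0 : f x ≠ 0) (hp : f (x + g) ≠ 0) (hm : f (x - g) ≠ 0) :
    f (u + g) * f (u + v + g) * f (v + g) =
      f (v + g) * f (u + v + g) * f (u + g) := by
  try field_simp
  try ring

lemma dy_001001 (f : ℂ → ℂ) (hodd : ∀ z, f (-z) = -f z) (h3 : ThreeTerm f)
    (u v x g : ℂ) (h0 : f x ≠ 0) (hp : f (x + g) ≠ 0) (hm : f (x - g) ≠ 0) :
    f (u + g) * f (u + v) * f (x - g) * f v * f (x - 2 * g) / (f x * f (x - g)) =
      f v * f (x - g) * f (u + v) * f (x - 2 * g) * f (u + g) / (f x * f (x - g)) := by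
  try field_simp
  try ring

lemma dy_001010 (f : ℂ → ℂ) (hodd : ∀ z, f (-z) = -f z) (h3 : ThreeTerm f)
    (u v x g : ℂ) (h0 : f x ≠ 0) (hp : f (x + g) ≠ 0) (hm : f (x - g) ≠ 0) :
    f (u + g) * f (u + v) * f (x - g) * f g * f (x - v - g) / (f x * f (x - g)) =
      f g * f (x - v) * f (u + v + g) * f u * f (x - g) / (f x * f x) + f v * f (x - g) * f g * f (x - u - v - g) * f g * f (x + u) / (f x * f (x - g) * f x) := by
  have h0 : f (x - v - g) * f x * f (u + g) * f (u + v) - f (x - u - v - g) * f g * f v * f (x + u) - f (x - v) * f (x - g) * f u * f (u + v + g) = 0 := by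
    have h := h3 (x - v / 2 - g / 2) (-v / 2 - g / 2) (u + v / 2 + g / 2) (-v / 2 + g / 2)
    rw [show (x - v / 2 - g / 2) + (-v / 2 - g / 2) = x - v - g by ring,
      show (x - v / 2 - g / 2) - (-v / 2 - g / 2) = x by ring,
      show (u + v / 2 + g / 2) + (-v / 2 + g / 2) = u + g by ring,
      show (u + v / 2 + g / 2) - (-v / 2 + g / 2) = u + v by ring,
      show (x - v / 2 - g / 2) + (u + v / 2 + g / 2) = x + u by ring,
      show (x - v / 2 - g / 2) - (u + v / 2 + g / 2) = x - u - v - g by ring,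
      show (-v / 2 - g / 2) + (-v / 2 + g / 2) = -(v) by ring,
      show (-v / 2 - g / 2) - (-v / 2 + g / 2) = -(g) by ring,
      show (x - v / 2 - g / 2) + (-v / 2 + g / 2) = x - v by ring,
      show (x - v / 2 - g / 2) - (-v / 2 + g / 2) = x - g by ring,
      show (-v / 2 - g / 2) + (u + v / 2 + g / 2) = u by ring,
      show (-v / 2 - g / 2) - (u + v / 2 + g / 2) = -(u + v + g) by ring] at h
    simp only [hodd] at h
    linear_combination h
  linear_combination (norm := skip) (f g * f (x - g)) / (f (x - g) * f x * f x) * h0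
  field_simp
  ring

lemma dy_001100 (f : ℂ → ℂ) (hodd : ∀ z, f (-z) = -f z) (h3 : ThreeTerm f)
    (u v x g : ℂ) (h0 : f x ≠ 0) (hp : f (x + g) ≠ 0) (hm : f (x - g) ≠ 0) :
    f (u + g) * f g * f (x - u - v) * f (v + g) / (f x) =
      f g * f (x - v) * f (u + v + g) * f g * f (x - u) / (f x * f x) + f v * f (x - g) * f g * f (x - u - v - g) * f u * f (x + g) / (f x * f (x - g) * f x) := by
  have h0 : f (x - u - v) * f x * f (v + g) * f (u + g) - f (x - u - v - g) * f (x + g) * f v * f u - f (x - u) * f (x - v) * f g * f (u + v + g) = 0 := by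
    have h := h3 (x - u / 2 - v / 2) (-u / 2 - v / 2) (u / 2 + v / 2 + g) (-u / 2 + v / 2)
    rw [show (x - u / 2 - v / 2) + (-u / 2 - v / 2) = x - u - v by ring,
      show (x - u / 2 - v / 2) - (-u / 2 - v / 2) = x by ring,
      show (u / 2 + v / 2 + g) + (-u / 2 + v / 2) = v + g by ring,
      show (u / 2 + v / 2 + g) - (-u / 2 + v / 2) = u + g by ring,
      show (x - u / 2 - v / 2) + (u / 2 + v / 2 + g) = x + g by ring,
      show (x - u / 2 - v / 2) - (u / 2 + v / 2 + g) = x - u - v - g by ring,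
      show (-u / 2 - v / 2) + (-u / 2 + v / 2) = -(u) by ring,
      show (-u / 2 - v / 2) - (-u / 2 + v / 2) = -(v) by ring,
      show (x - u / 2 - v / 2) + (-u / 2 + v / 2) = x - u by ring,
      show (x - u / 2 - v / 2) - (-u / 2 + v / 2) = x - v by ring,
      show (-u / 2 - v / 2) + (u / 2 + v / 2 + g) = g by ring,
      show (-u / 2 - v / 2) - (u / 2 + v / 2 + g) = -(u + v + g) by ring] at h
    simp only [hodd] at h
    linear_combination h
  linear_combination (norm := skip) (f g * f (x - g)) / (f (x - g) * f x * f x) * h0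
  field_simp
  ring

lemma dy_010001 (f : ℂ → ℂ) (hodd : ∀ z, f (-z) = -f z) (h3 : ThreeTerm f)
    (u v x g : ℂ) (h0 : f x ≠ 0) (hp : f (x + g) ≠ 0) (hm : f (x - g) ≠ 0) :
    f u * f (x - 2 * g) * f (u + v + g) * f g * f (x + v - g) / (f (x - g) * f (x - g)) + f g * f (x - u - g) * f g * f (x + u + v) * f v * f (x - 2 * g) / (f (x - g) * f x * f (x - g)) =
      f g * f (x + v) * f (u + v) * f (x - 2 * g) * f (u + g) / (f x * f (x - g)) := by
  have h0 : f (x - g) * f (x + v) * f (u + g) * f (u + v) - f (x - u - g) * f g * f v * f (x + u + v) - f x * f (x + v - g) * f u * f (u + v + g) = 0 := by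
    have h := h3 (x + v / 2 - g / 2) (-v / 2 - g / 2) (u + v / 2 + g / 2) (-v / 2 + g / 2)
    rw [show (x + v / 2 - g / 2) + (-v / 2 - g / 2) = x - g by ring,
      show (x + v / 2 - g / 2) - (-v / 2 - g / 2) = x + v by ring,
      show (u + v / 2 + g / 2) + (-v / 2 + g / 2) = u + g by ring,
      show (u + v / 2 + g / 2) - (-v / 2 + g / 2) = u + v by ring,
      show (x + v / 2 - g / 2) + (u + v / 2 + g / 2) = x + u + v by ring,
      show (x + v / 2 - g / 2) - (u + v / 2 + g / 2) = x - u - g by ring,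
      show (-v / 2 - g / 2) + (-v / 2 + g / 2) = -(v) by ring,
      show (-v / 2 - g / 2) - (-v / 2 + g / 2) = -(g) by ring,
      show (x + v / 2 - g / 2) + (-v / 2 + g / 2) = x by ring,
      show (x + v / 2 - g / 2) - (-v / 2 + g / 2) = x + v - g by ring,
      show (-v / 2 - g / 2) + (u + v / 2 + g / 2) = u by ring,
      show (-v / 2 - g / 2) - (u + v / 2 + g / 2) = -(u + v + g) by ring] at h
    simp only [hodd] at h
    linear_combination h
  linear_combination (norm := skip) -(f g * f (x - 2 * g)) / (f (x - g) * f (x - g) * f x) * h0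
  field_simp
  ring

lemma dy_010010 (f : ℂ → ℂ) (hodd : ∀ z, f (-z) = -f z) (h3 : ThreeTerm f)
    (u v x g : ℂ) (h0 : f x ≠ 0) (hp : f (x + g) ≠ 0) (hm : f (x - g) ≠ 0) :
    f u * f (x - 2 * g) * f (u + v + g) * f v * f x / (f (x - g) * f (x - g)) + f g * f (x - u - g) * f g * f (x + u + v) * f g * f (x - v - g) / (f (x - g) * f x * f (x - g)) =
      f v * f (x + g) * f (u + v + g) * f u * f (x - g) / (f x * f x) + f g * f (x + v) * f g * f (x - u - v - g) * f g * f (x + u) / (f x * f (x - g) * f x) := by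
  have h0 : f (x - 2 * g) * f x * f x * f x + f g * f g * f g * f (2 * x - g) - f (x - g) * f (x - g) * f (x - g) * f (x + g) = 0 := by
    have h := h3 (x - g) (-g) (x) (0)
    rw [show (x - g) + (-g) = x - 2 * g by ring,
      show (x - g) - (-g) = x by ring,
      show (x) + (0) = x by ring,
      show (x) - (0) = x by ring,
      show (x - g) + (x) = 2 * x - g by ring,
      show (x - g) - (x) = -(g) by ring,
      show (-g) + (0) = -(g) by ring,
      show (-g) - (0) = -(g) by ring,
      show (x - g) + (0) = x - g by ring,
      show (x - g) - (0) = x - g by ring,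
      show (-g) + (x) = x - g by ring,
      show (-g) - (x) = -(x + g) by ring] at h
    simp only [hodd] at h
    linear_combination h
  have h1 : f (x - u - g) * f (x - v - g) * f x * f (x + u + v) - f (2 * x - g) * f v * f u * f (u + v + g) - f (x - u - v - g) * f (x - g) * f (x + v) * f (x + u) = 0 := by
    have h := h3 (x - u / 2 - v / 2 - g) (-u / 2 + v / 2) (x + u / 2 + v / 2) (-u / 2 - v / 2)
    rw [show (x - u / 2 - v / 2 - g) + (-u / 2 + v / 2) = x - u - g by ring,
      show (x - u / 2 - v / 2 - g) - (-u / 2 + v / 2) = x - v - g by ring,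
      show (x + u / 2 + v / 2) + (-u / 2 - v / 2) = x by ring,
      show (x + u / 2 + v / 2) - (-u / 2 - v / 2) = x + u + v by ring,
      show (x - u / 2 - v / 2 - g) + (x + u / 2 + v / 2) = 2 * x - g by ring,
      show (x - u / 2 - v / 2 - g) - (x + u / 2 + v / 2) = -(u + v + g) by ring,
      show (-u / 2 + v / 2) + (-u / 2 - v / 2) = -(u) by ring,
      show (-u / 2 + v / 2) - (-u / 2 - v / 2) = v by ring,
      show (x - u / 2 - v / 2 - g) + (-u / 2 - v / 2) = x - u - v - g by ring,
      show (x - u / 2 - v / 2 - g) - (-u / 2 - v / 2) = x - g by ring,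
      show (-u / 2 + v / 2) + (x + u / 2 + v / 2) = x + v by ring,
      show (-u / 2 + v / 2) - (x + u / 2 + v / 2) = -(x + u) by ring] at h
    simp only [hodd] at h
    linear_combination h
  linear_combination (norm := skip) (f v * f u * f (u + v + g)) / (f (x - g) * f (x - g) * f x * f x) * h0 + (f g * f g * f g) / (f (x - g) * f (x - g) * f x * f x) * h1
  field_simp
  ring

lemma dy_010100 (f : ℂ → ℂ) (hodd : ∀ z, f (-z) = -f z) (h3 : ThreeTerm f)
    (u v x g : ℂ) (h0 : f x ≠ 0) (hp : f (x + g) ≠ 0) (hm : f (x - g) ≠ 0) :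
    f g * f (x - u - g) * f (u + v) * f (x + g) * f (v + g) / (f (x - g) * f x) =
      f v * f (x + g) * f (u + v + g) * f g * f (x - u) / (f x * f x) + f g * f (x + v) * f g * f (x - u - v - g) * f u * f (x + g) / (f x * f (x - g) * f x) := by
  have h0 : f (x - u) * f (x - g) * f v * f (u + v + g) + f (x - u - v - g) * f g * f (x + v) * f u - f (x - u - g) * f x * f (v + g) * f (u + v) = 0 := by
    have h := h3 (x - u / 2 - g / 2) (-u / 2 + g / 2) (u / 2 + v + g / 2) (-u / 2 - g / 2)
    rw [show (x - u / 2 - g / 2) + (-u / 2 + g / 2) = x - u by ring,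
      show (x - u / 2 - g / 2) - (-u / 2 + g / 2) = x - g by ring,
      show (u / 2 + v + g / 2) + (-u / 2 - g / 2) = v by ring,
      show (u / 2 + v + g / 2) - (-u / 2 - g / 2) = u + v + g by ring,
      show (x - u / 2 - g / 2) + (u / 2 + v + g / 2) = x + v by ring,
      show (x - u / 2 - g / 2) - (u / 2 + v + g / 2) = x - u - v - g by ring,
      show (-u / 2 + g / 2) + (-u / 2 - g / 2) = -(u) by ring,
      show (-u / 2 + g / 2) - (-u / 2 - g / 2) = g by ring,
      show (x - u / 2 - g / 2) + (-u / 2 - g / 2) = x - u - g by ring,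
      show (x - u / 2 - g / 2) - (-u / 2 - g / 2) = x by ring,
      show (-u / 2 + g / 2) + (u / 2 + v + g / 2) = v + g by ring,
      show (-u / 2 + g / 2) - (u / 2 + v + g / 2) = -(u + v) by ring] at h
    simp only [hodd] at h
    linear_combination h
  linear_combination (norm := skip) -(f g * f (x + g)) / (f (x - g) * f x * f x) * h0
  field_simp
  ring

lemma dy_011011 (f : ℂ → ℂ) (hodd : ∀ z, f (-z) = -f z) (h3 : ThreeTerm f)
    (u v x g : ℂ) (h0 : f x ≠ 0) (hp : f (x + g) ≠ 0) (hm : f (x - g) ≠ 0) :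
    f u * f x * f (u + v) * f (x - g) * f (v + g) / (f (x + g) * f x) =
      f (v + g) * f (u + v) * f x * f u * f (x - g) / (f (x + g) * f x) := by
  try field_simp
  try ring

lemma dy_011101 (f : ℂ → ℂ) (hodd : ∀ z, f (-z) = -f z) (h3 : ThreeTerm f)
    (u v x g : ℂ) (h0 : f x ≠ 0) (hp : f (x + g) ≠ 0) (hm : f (x - g) ≠ 0) :
    f u * f x * f g * f (x - u - v) * f g * f (x + v + g) / (f (x + g) * f x * f (x + g)) + f g * f (x - u + g) * f (u + v + g) * f v * f x / (f (x + g) * f (x + g)) =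
      f (v + g) * f (u + v) * f x * f g * f (x - u) / (f (x + g) * f x) := by
  have h0 : f (x - u - v) * f g * f (x + v + g) * f u - f (x - u) * f (x + g) * f (v + g) * f (u + v) + f (x - u + g) * f x * f v * f (u + v + g) = 0 := by
    have h := h3 (x / 2 - u / 2 - v / 2 + g / 2) (x / 2 - u / 2 - v / 2 - g / 2) (x / 2 + u / 2 + v / 2 + g / 2) (x / 2 - u / 2 + v / 2 + g / 2)
    rw [show (x / 2 - u / 2 - v / 2 + g / 2) + (x / 2 - u / 2 - v / 2 - g / 2) = x - u - v by ring,
      show (x / 2 - u / 2 - v / 2 + g / 2) - (x / 2 - u / 2 - v / 2 - g / 2) = g by ring,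
      show (x / 2 + u / 2 + v / 2 + g / 2) + (x / 2 - u / 2 + v / 2 + g / 2) = x + v + g by ring,
      show (x / 2 + u / 2 + v / 2 + g / 2) - (x / 2 - u / 2 + v / 2 + g / 2) = u by ring,
      show (x / 2 - u / 2 - v / 2 + g / 2) + (x / 2 + u / 2 + v / 2 + g / 2) = x + g by ring,
      show (x / 2 - u / 2 - v / 2 + g / 2) - (x / 2 + u / 2 + v / 2 + g / 2) = -(u + v) by ring,
      show (x / 2 - u / 2 - v / 2 - g / 2) + (x / 2 - u / 2 + v / 2 + g / 2) = x - u by ring,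
      show (x / 2 - u / 2 - v / 2 - g / 2) - (x / 2 - u / 2 + v / 2 + g / 2) = -(v + g) by ring,
      show (x / 2 - u / 2 - v / 2 + g / 2) + (x / 2 - u / 2 + v / 2 + g / 2) = x - u + g by ring,
      show (x / 2 - u / 2 - v / 2 + g / 2) - (x / 2 - u / 2 + v / 2 + g / 2) = -(v) by ring,
      show (x / 2 - u / 2 - v / 2 - g / 2) + (x / 2 + u / 2 + v / 2 + g / 2) = x by ring,
      show (x / 2 - u / 2 - v / 2 - g / 2) - (x / 2 + u / 2 + v / 2 + g / 2) = -(u + v + g) by ring] at h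
    simp only [hodd] at h
    linear_combination h
  linear_combination (norm := skip) (f g * f x) / (f x * f (x + g) * f (x + g)) * h0
  field_simp
  ring

lemma dy_011110 (f : ℂ → ℂ) (hodd : ∀ z, f (-z) = -f z) (h3 : ThreeTerm f)
    (u v x g : ℂ) (h0 : f x ≠ 0) (hp : f (x + g) ≠ 0) (hm : f (x - g) ≠ 0) :
    f u * f x * f g * f (x - u - v) * f v * f (x + 2 * g) / (f (x + g) * f x * f (x + g)) + f g * f (x - u + g) * f (u + v + g) * f g * f (x - v + g) / (f (x + g) * f (x + g)) =
      f (v + g) * f g * f (x - u - v + g) * f (u + g) / (f (x + g)) := by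
  have h0 : f (x - u - v) * f (x + 2 * g) * f v * f u - f (x - u - v + g) * f (x + g) * f (v + g) * f (u + g) + f (x - u + g) * f (x - v + g) * f g * f (u + v + g) = 0 := by
    have h := h3 (x - u / 2 - v / 2 + g) (-u / 2 - v / 2 - g) (u / 2 + v / 2) (-u / 2 + v / 2)
    rw [show (x - u / 2 - v / 2 + g) + (-u / 2 - v / 2 - g) = x - u - v by ring,
      show (x - u / 2 - v / 2 + g) - (-u / 2 - v / 2 - g) = x + 2 * g by ring,
      show (u / 2 + v / 2) + (-u / 2 + v / 2) = v by ring,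
      show (u / 2 + v / 2) - (-u / 2 + v / 2) = u by ring,
      show (x - u / 2 - v / 2 + g) + (u / 2 + v / 2) = x + g by ring,
      show (x - u / 2 - v / 2 + g) - (u / 2 + v / 2) = x - u - v + g by ring,
      show (-u / 2 - v / 2 - g) + (-u / 2 + v / 2) = -(u + g) by ring,
      show (-u / 2 - v / 2 - g) - (-u / 2 + v / 2) = -(v + g) by ring,
      show (x - u / 2 - v / 2 + g) + (-u / 2 + v / 2) = x - u + g by ring,
      show (x - u / 2 - v / 2 + g) - (-u / 2 + v / 2) = x - v + g by ring,
      show (-u / 2 - v / 2 - g) + (u / 2 + v / 2) = -(g) by ring,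
      show (-u / 2 - v / 2 - g) - (u / 2 + v / 2) = -(u + v + g) by ring] at h
    simp only [hodd] at h
    linear_combination h
  linear_combination (norm := skip) (f g * f x) / (f x * f (x + g) * f (x + g)) * h0
  field_simp
  ring

lemma dy_100001 (f : ℂ → ℂ) (hodd : ∀ z, f (-z) = -f z) (h3 : ThreeTerm f)
    (u v x g : ℂ) (h0 : f x ≠ 0) (hp : f (x + g) ≠ 0) (hm : f (x - g) ≠ 0) :
    f g * f (x + u - g) * f (u + v + g) * f g * f (x + v - g) / (f (x - g) * f (x - g)) + f u * f x * f g * f (x + u + v) * f v * f (x - 2 * g) / (f (x - g) * f x * f (x - g)) =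
      f (v + g) * f g * f (x + u + v - g) * f (u + g) / (f (x - g)) := by
  have h0 : f (x - g) * f (v + g) * f (u + g) * f (x + u + v - g) - f (x - 2 * g) * f v * f u * f (x + u + v) - f g * f (x + v - g) * f (x + u - g) * f (u + v + g) = 0 := by
    have h := h3 (x / 2 + v / 2) (x / 2 - v / 2 - g) (x / 2 + u + v / 2) (-x / 2 - v / 2 + g)
    rw [show (x / 2 + v / 2) + (x / 2 - v / 2 - g) = x - g by ring,
      show (x / 2 + v / 2) - (x / 2 - v / 2 - g) = v + g by ring,
      show (x / 2 + u + v / 2) + (-x / 2 - v / 2 + g) = u + g by ring,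
      show (x / 2 + u + v / 2) - (-x / 2 - v / 2 + g) = x + u + v - g by ring,
      show (x / 2 + v / 2) + (x / 2 + u + v / 2) = x + u + v by ring,
      show (x / 2 + v / 2) - (x / 2 + u + v / 2) = -(u) by ring,
      show (x / 2 - v / 2 - g) + (-x / 2 - v / 2 + g) = -(v) by ring,
      show (x / 2 - v / 2 - g) - (-x / 2 - v / 2 + g) = x - 2 * g by ring,
      show (x / 2 + v / 2) + (-x / 2 - v / 2 + g) = g by ring,
      show (x / 2 + v / 2) - (-x / 2 - v / 2 + g) = x + v - g by ring,
      show (x / 2 - v / 2 - g) + (x / 2 + u + v / 2) = x + u - g by ring,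
      show (x / 2 - v / 2 - g) - (x / 2 + u + v / 2) = -(u + v + g) by ring] at h
    simp only [hodd] at h
    linear_combination h
  linear_combination (norm := skip) -(f g * f x) / (f (x - g) * f (x - g) * f x) * h0
  field_simp
  ring

lemma dy_100010 (f : ℂ → ℂ) (hodd : ∀ z, f (-z) = -f z) (h3 : ThreeTerm f)
    (u v x g : ℂ) (h0 : f x ≠ 0) (hp : f (x + g) ≠ 0) (hm : f (x - g) ≠ 0) :
    f g * f (x + u - g) * f (u + v + g) * f v * f x / (f (x - g) * f (x - g)) + f u * f x * f g * f (x + u + v) * f g * f (x - v - g) / (f (x - g) * f x * f (x - g)) =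
      f (v + g) * f (u + v) * f x * f g * f (x + u) / (f (x - g) * f x) := by
  have h0 : f x * f v * f (x + u - g) * f (u + v + g) + f (x - v - g) * f g * f u * f (x + u + v) - f (x - g) * f (v + g) * f (x + u) * f (u + v) = 0 := by
    have h := h3 (x / 2 + v / 2) (x / 2 - v / 2) (x / 2 + u + v / 2) (x / 2 - v / 2 - g)
    rw [show (x / 2 + v / 2) + (x / 2 - v / 2) = x by ring,
      show (x / 2 + v / 2) - (x / 2 - v / 2) = v by ring,
      show (x / 2 + u + v / 2) + (x / 2 - v / 2 - g) = x + u - g by ring,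
      show (x / 2 + u + v / 2) - (x / 2 - v / 2 - g) = u + v + g by ring,
      show (x / 2 + v / 2) + (x / 2 + u + v / 2) = x + u + v by ring,
      show (x / 2 + v / 2) - (x / 2 + u + v / 2) = -(u) by ring,
      show (x / 2 - v / 2) + (x / 2 - v / 2 - g) = x - v - g by ring,
      show (x / 2 - v / 2) - (x / 2 - v / 2 - g) = g by ring,
      show (x / 2 + v / 2) + (x / 2 - v / 2 - g) = x - g by ring,
      show (x / 2 + v / 2) - (x / 2 - v / 2 - g) = v + g by ring,
      show (x / 2 - v / 2) + (x / 2 + u + v / 2) = x + u by ring,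
      show (x / 2 - v / 2) - (x / 2 + u + v / 2) = -(u + v) by ring] at h
    simp only [hodd] at h
    linear_combination h
  linear_combination (norm := skip) (f g * f x) / (f (x - g) * f (x - g) * f x) * h0
  field_simp
  ring

lemma dy_100100 (f : ℂ → ℂ) (hodd : ∀ z, f (-z) = -f z) (h3 : ThreeTerm f)
    (u v x g : ℂ) (h0 : f x ≠ 0) (hp : f (x + g) ≠ 0) (hm : f (x - g) ≠ 0) :
    f u * f x * f (u + v) * f (x + g) * f (v + g) / (f (x - g) * f x) =
      f (v + g) * f (u + v) * f x * f u * f (x + g) / (f (x - g) * f x) := by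
  try field_simp
  try ring

lemma dy_101011 (f : ℂ → ℂ) (hodd : ∀ z, f (-z) = -f z) (h3 : ThreeTerm f)
    (u v x g : ℂ) (h0 : f x ≠ 0) (hp : f (x + g) ≠ 0) (hm : f (x - g) ≠ 0) :
    f g * f (x + u + g) * f (u + v) * f (x - g) * f (v + g) / (f (x + g) * f x) =
      f g * f (x - v) * f g * f (x + u + v + g) * f u * f (x - g) / (f x * f (x + g) * f x) + f v * f (x - g) * f (u + v + g) * f g * f (x + u) / (f x * f x) := by
  have h0 : f (x - v) * f g * f u * f (x + u + v + g) - f x * f (v + g) * f (x + u + g) * f (u + v) + f (x + g) * f v * f (x + u) * f (u + v + g) = 0 := by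
    have h := h3 (x / 2 - v / 2 + g / 2) (x / 2 - v / 2 - g / 2) (x / 2 + u + v / 2 + g / 2) (-x / 2 - v / 2 - g / 2)
    rw [show (x / 2 - v / 2 + g / 2) + (x / 2 - v / 2 - g / 2) = x - v by ring,
      show (x / 2 - v / 2 + g / 2) - (x / 2 - v / 2 - g / 2) = g by ring,
      show (x / 2 + u + v / 2 + g / 2) + (-x / 2 - v / 2 - g / 2) = u by ring,
      show (x / 2 + u + v / 2 + g / 2) - (-x / 2 - v / 2 - g / 2) = x + u + v + g by ring,
      show (x / 2 - v / 2 + g / 2) + (x / 2 + u + v / 2 + g / 2) = x + u + g by ring,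
      show (x / 2 - v / 2 + g / 2) - (x / 2 + u + v / 2 + g / 2) = -(u + v) by ring,
      show (x / 2 - v / 2 - g / 2) + (-x / 2 - v / 2 - g / 2) = -(v + g) by ring,
      show (x / 2 - v / 2 - g / 2) - (-x / 2 - v / 2 - g / 2) = x by ring,
      show (x / 2 - v / 2 + g / 2) + (-x / 2 - v / 2 - g / 2) = -(v) by ring,
      show (x / 2 - v / 2 + g / 2) - (-x / 2 - v / 2 - g / 2) = x + g by ring,
      show (x / 2 - v / 2 - g / 2) + (x / 2 + u + v / 2 + g / 2) = x + u by ring,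
      show (x / 2 - v / 2 - g / 2) - (x / 2 + u + v / 2 + g / 2) = -(u + v + g) by ring] at h
    simp only [hodd] at h
    linear_combination h
  linear_combination (norm := skip) -(f g * f (x - g)) / (f x * f x * f (x + g)) * h0
  field_simp
  ring

lemma dy_101101 (f : ℂ → ℂ) (hodd : ∀ z, f (-z) = -f z) (h3 : ThreeTerm f)
    (u v x g : ℂ) (h0 : f x ≠ 0) (hp : f (x + g) ≠ 0) (hm : f (x - g) ≠ 0) :
    f g * f (x + u + g) * f g * f (x - u - v) * f g * f (x + v + g) / (f (x + g) * f x * f (x + g)) + f u * f (x + 2 * g) * f (u + v + g) * f v * f x / (f (x + g) * f (x + g)) =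
      f g * f (x - v) * f g * f (x + u + v + g) * f g * f (x - u) / (f x * f (x + g) * f x) + f v * f (x - g) * f (u + v + g) * f u * f (x + g) / (f x * f x) := by
  have h0 : f (x - u - v) * f x * f (x + v + g) * f (x + u + g) + f (2 * x + g) * f v * f u * f (u + v + g) - f (x - u) * f (x - v) * f (x + g) * f (x + u + v + g) = 0 := by
    have h := h3 (x - u / 2 - v / 2) (-u / 2 - v / 2) (x + u / 2 + v / 2 + g) (-u / 2 + v / 2)
    rw [show (x - u / 2 - v / 2) + (-u / 2 - v / 2) = x - u - v by ring,
      show (x - u / 2 - v / 2) - (-u / 2 - v / 2) = x by ring,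
      show (x + u / 2 + v / 2 + g) + (-u / 2 + v / 2) = x + v + g by ring,
      show (x + u / 2 + v / 2 + g) - (-u / 2 + v / 2) = x + u + g by ring,
      show (x - u / 2 - v / 2) + (x + u / 2 + v / 2 + g) = 2 * x + g by ring,
      show (x - u / 2 - v / 2) - (x + u / 2 + v / 2 + g) = -(u + v + g) by ring,
      show (-u / 2 - v / 2) + (-u / 2 + v / 2) = -(u) by ring,
      show (-u / 2 - v / 2) - (-u / 2 + v / 2) = -(v) by ring,
      show (x - u / 2 - v / 2) + (-u / 2 + v / 2) = x - u by ring,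
      show (x - u / 2 - v / 2) - (-u / 2 + v / 2) = x - v by ring,
      show (-u / 2 - v / 2) + (x + u / 2 + v / 2 + g) = x + g by ring,
      show (-u / 2 - v / 2) - (x + u / 2 + v / 2 + g) = -(x + u + v + g) by ring] at h
    simp only [hodd] at h
    linear_combination h
  have h1 : f x * f x * f x * f (x + 2 * g) - f g * f g * f g * f (2 * x + g) - f (x - g) * f (x + g) * f (x + g) * f (x + g) = 0 := by
    have h := h3 (x) (0) (x + g) (-g)
    rw [show (x) + (0) = x by ring,
      show (x) - (0) = x by ring,
      show (x + g) + (-g) = x by ring,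
      show (x + g) - (-g) = x + 2 * g by ring,
      show (x) + (x + g) = 2 * x + g by ring,
      show (x) - (x + g) = -(g) by ring,
      show (0) + (-g) = -(g) by ring,
      show (0) - (-g) = g by ring,
      show (x) + (-g) = x - g by ring,
      show (x) - (-g) = x + g by ring,
      show (0) + (x + g) = x + g by ring,
      show (0) - (x + g) = -(x + g) by ring] at h
    simp only [hodd] at h
    linear_combination h
  linear_combination (norm := skip) (f g * f g * f g) / (f x * f x * f (x + g) * f (x + g)) * h0 + (f v * f u * f (u + v + g)) / (f x * f x * f (x + g) * f (x + g)) * h1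
  field_simp
  ring

lemma dy_101110 (f : ℂ → ℂ) (hodd : ∀ z, f (-z) = -f z) (h3 : ThreeTerm f)
    (u v x g : ℂ) (h0 : f x ≠ 0) (hp : f (x + g) ≠ 0) (hm : f (x - g) ≠ 0) :
    f g * f (x + u + g) * f g * f (x - u - v) * f v * f (x + 2 * g) / (f (x + g) * f x * f (x + g)) + f u * f (x + 2 * g) * f (u + v + g) * f g * f (x - v + g) / (f (x + g) * f (x + g)) =
      f g * f (x - v) * f (u + v) * f (x + 2 * g) * f (u + g) / (f x * f (x + g)) := by
  have h0 : f (x - u - v) * f g * f v * f (x + u + g) - f (x - v) * f (x + g) * f (u + g) * f (u + v) + f (x - v + g) * f x * f u * f (u + v + g) = 0 := by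
    have h := h3 (x / 2 - u / 2 - v / 2 + g / 2) (x / 2 - u / 2 - v / 2 - g / 2) (x / 2 + u / 2 + v / 2 + g / 2) (-x / 2 - u / 2 + v / 2 - g / 2)
    rw [show (x / 2 - u / 2 - v / 2 + g / 2) + (x / 2 - u / 2 - v / 2 - g / 2) = x - u - v by ring,
      show (x / 2 - u / 2 - v / 2 + g / 2) - (x / 2 - u / 2 - v / 2 - g / 2) = g by ring,
      show (x / 2 + u / 2 + v / 2 + g / 2) + (-x / 2 - u / 2 + v / 2 - g / 2) = v by ring,
      show (x / 2 + u / 2 + v / 2 + g / 2) - (-x / 2 - u / 2 + v / 2 - g / 2) = x + u + g by ring,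
      show (x / 2 - u / 2 - v / 2 + g / 2) + (x / 2 + u / 2 + v / 2 + g / 2) = x + g by ring,
      show (x / 2 - u / 2 - v / 2 + g / 2) - (x / 2 + u / 2 + v / 2 + g / 2) = -(u + v) by ring,
      show (x / 2 - u / 2 - v / 2 - g / 2) + (-x / 2 - u / 2 + v / 2 - g / 2) = -(u + g) by ring,
      show (x / 2 - u / 2 - v / 2 - g / 2) - (-x / 2 - u / 2 + v / 2 - g / 2) = x - v by ring,
      show (x / 2 - u / 2 - v / 2 + g / 2) + (-x / 2 - u / 2 + v / 2 - g / 2) = -(u) by ring,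
      show (x / 2 - u / 2 - v / 2 + g / 2) - (-x / 2 - u / 2 + v / 2 - g / 2) = x - v + g by ring,
      show (x / 2 - u / 2 - v / 2 - g / 2) + (x / 2 + u / 2 + v / 2 + g / 2) = x by ring,
      show (x / 2 - u / 2 - v / 2 - g / 2) - (x / 2 + u / 2 + v / 2 + g / 2) = -(u + v + g) by ring] at h
    simp only [hodd] at h
    linear_combination h
  linear_combination (norm := skip) (f g * f (x + 2 * g)) / (f x * f (x + g) * f (x + g)) * h0
  field_simp
  ring

lemma dy_110011 (f : ℂ → ℂ) (hodd : ∀ z, f (-z) = -f z) (h3 : ThreeTerm f)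
    (u v x g : ℂ) (h0 : f x ≠ 0) (hp : f (x + g) ≠ 0) (hm : f (x - g) ≠ 0) :
    f (u + g) * f g * f (x + u + v) * f (v + g) / (f x) =
      f v * f (x + g) * f g * f (x + u + v + g) * f u * f (x - g) / (f x * f (x + g) * f x) + f g * f (x + v) * f (u + v + g) * f g * f (x + u) / (f x * f x) := by
  have h0 : f (x - g) * f v * f u * f (x + u + v + g) - f x * f (v + g) * f (u + g) * f (x + u + v) + f g * f (x + v) * f (x + u) * f (u + v + g) = 0 := by
    have h := h3 (x / 2 + v / 2 - g / 2) (x / 2 - v / 2 - g / 2) (x / 2 + u + v / 2 + g / 2) (-x / 2 - v / 2 - g / 2)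
    rw [show (x / 2 + v / 2 - g / 2) + (x / 2 - v / 2 - g / 2) = x - g by ring,
      show (x / 2 + v / 2 - g / 2) - (x / 2 - v / 2 - g / 2) = v by ring,
      show (x / 2 + u + v / 2 + g / 2) + (-x / 2 - v / 2 - g / 2) = u by ring,
      show (x / 2 + u + v / 2 + g / 2) - (-x / 2 - v / 2 - g / 2) = x + u + v + g by ring,
      show (x / 2 + v / 2 - g / 2) + (x / 2 + u + v / 2 + g / 2) = x + u + v by ring,
      show (x / 2 + v / 2 - g / 2) - (x / 2 + u + v / 2 + g / 2) = -(u + g) by ring,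
      show (x / 2 - v / 2 - g / 2) + (-x / 2 - v / 2 - g / 2) = -(v + g) by ring,
      show (x / 2 - v / 2 - g / 2) - (-x / 2 - v / 2 - g / 2) = x by ring,
      show (x / 2 + v / 2 - g / 2) + (-x / 2 - v / 2 - g / 2) = -(g) by ring,
      show (x / 2 + v / 2 - g / 2) - (-x / 2 - v / 2 - g / 2) = x + v by ring,
      show (x / 2 - v / 2 - g / 2) + (x / 2 + u + v / 2 + g / 2) = x + u by ring,
      show (x / 2 - v / 2 - g / 2) - (x / 2 + u + v / 2 + g / 2) = -(u + v + g) by ring] at h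
    simp only [hodd] at h
    linear_combination h
  linear_combination (norm := skip) -(f g * f (x + g)) / (f x * f x * f (x + g)) * h0
  field_simp
  ring

lemma dy_110101 (f : ℂ → ℂ) (hodd : ∀ z, f (-z) = -f z) (h3 : ThreeTerm f)
    (u v x g : ℂ) (h0 : f x ≠ 0) (hp : f (x + g) ≠ 0) (hm : f (x - g) ≠ 0) :
    f (u + g) * f (u + v) * f (x + g) * f g * f (x + v + g) / (f x * f (x + g)) =
      f v * f (x + g) * f g * f (x + u + v + g) * f g * f (x - u) / (f x * f (x + g) * f x) + f g * f (x + v) * f (u + v + g) * f u * f (x + g) / (f x * f x) := by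
  have h0 : f (x - u) * f g * f v * f (x + u + v + g) - f x * f (x + v + g) * f (u + g) * f (u + v) + f (x + g) * f (x + v) * f u * f (u + v + g) = 0 := by
    have h := h3 (x / 2 - u / 2 + g / 2) (x / 2 - u / 2 - g / 2) (x / 2 + u / 2 + v + g / 2) (-x / 2 - u / 2 - g / 2)
    rw [show (x / 2 - u / 2 + g / 2) + (x / 2 - u / 2 - g / 2) = x - u by ring,
      show (x / 2 - u / 2 + g / 2) - (x / 2 - u / 2 - g / 2) = g by ring,
      show (x / 2 + u / 2 + v + g / 2) + (-x / 2 - u / 2 - g / 2) = v by ring,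
      show (x / 2 + u / 2 + v + g / 2) - (-x / 2 - u / 2 - g / 2) = x + u + v + g by ring,
      show (x / 2 - u / 2 + g / 2) + (x / 2 + u / 2 + v + g / 2) = x + v + g by ring,
      show (x / 2 - u / 2 + g / 2) - (x / 2 + u / 2 + v + g / 2) = -(u + v) by ring,
      show (x / 2 - u / 2 - g / 2) + (-x / 2 - u / 2 - g / 2) = -(u + g) by ring,
      show (x / 2 - u / 2 - g / 2) - (-x / 2 - u / 2 - g / 2) = x by ring,
      show (x / 2 - u / 2 + g / 2) + (-x / 2 - u / 2 - g / 2) = -(u) by ring,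
      show (x / 2 - u / 2 + g / 2) - (-x / 2 - u / 2 - g / 2) = x + g by ring,
      show (x / 2 - u / 2 - g / 2) + (x / 2 + u / 2 + v + g / 2) = x + v by ring,
      show (x / 2 - u / 2 - g / 2) - (x / 2 + u / 2 + v + g / 2) = -(u + v + g) by ring] at h
    simp only [hodd] at h
    linear_combination h
  linear_combination (norm := skip) -(f g * f (x + g)) / (f x * f x * f (x + g)) * h0
  field_simp
  ring

lemma dy_110110 (f : ℂ → ℂ) (hodd : ∀ z, f (-z) = -f z) (h3 : ThreeTerm f)
    (u v x g : ℂ) (h0 : f x ≠ 0) (hp : f (x + g) ≠ 0) (hm : f (x - g) ≠ 0) :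
    f (u + g) * f (u + v) * f (x + g) * f v * f (x + 2 * g) / (f x * f (x + g)) =
      f v * f (x + g) * f (u + v) * f (x + 2 * g) * f (u + g) / (f x * f (x + g)) := by
  try field_simp
  try ring

lemma dy_111111 (f : ℂ → ℂ) (hodd : ∀ z, f (-z) = -f z) (h3 : ThreeTerm f)
    (u v x g : ℂ) (h0 : f x ≠ 0) (hp : f (x + g) ≠ 0) (hm : f (x - g) ≠ 0) :
    f (u + g) * f (u + v + g) * f (v + g) =
      f (v + g) * f (u + v + g) * f (u + g) := by
  try field_simp
  try ring

lemma dybe {τ : ℂ} (hτ : 0 < τ.im) (γ u v x : ℂ) (h0 : thetaf τ x ≠ 0)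
    (hp : thetaf τ (x + γ) ≠ 0) (hm : thetaf τ (x - γ) ≠ 0) (a b s e g t : Fin 2) :
    ∑ i, ∑ j, ∑ r, Rdyn τ γ u (x - γ * eps s) (a, b) (i, j) *
        Rdyn τ γ (u + v) x (i, s) (e, r) * Rdyn τ γ v (x - γ * eps e) (j, r) (g, t) =
    ∑ i, ∑ j, ∑ r, Rdyn τ γ v x (b, s) (j, r) *
        Rdyn τ γ (u + v) (x - γ * eps j) (a, r) (i, t) * Rdyn τ γ u x (i, j) (e, g) := by
  have hodd := thetaf_neg τ
  have h3 : ThreeTerm (thetaf τ) := thetaf_three hτ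
  fin_cases a <;> fin_cases b <;> fin_cases s <;> fin_cases e <;> fin_cases g <;> fin_cases t <;>
    simp only [Fin.sum_univ_two, Fin.zero_eta, Fin.mk_one, Fin.isValue, Rdyn, eps, Prod.mk.injEq,
      one_ne_zero, zero_ne_one, and_true, true_and, and_false, false_and, and_self, if_true,
      if_false, mul_zero, zero_mul, add_zero, zero_add, mul_one, mul_neg, reduceIte]
  · linear_combination (norm := ring_nf) dy_000000 (thetaf τ) hodd h3 u v x γ h0 hp hm
  · linear_combination (norm := ring_nf) dy_001001 (thetaf τ) hodd h3 u v x γ h0 hp hm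
  · linear_combination (norm := ring_nf) dy_001010 (thetaf τ) hodd h3 u v x γ h0 hp hm
  · linear_combination (norm := ring_nf) dy_001100 (thetaf τ) hodd h3 u v x γ h0 hp hm
  · linear_combination (norm := ring_nf) dy_010001 (thetaf τ) hodd h3 u v x γ h0 hp hm
  · linear_combination (norm := ring_nf) dy_010010 (thetaf τ) hodd h3 u v x γ h0 hp hm
  · linear_combination (norm := ring_nf) dy_010100 (thetaf τ) hodd h3 u v x γ h0 hp hm
  · linear_combination (norm := ring_nf) dy_011011 (thetaf τ) hodd h3 u v x γ h0 hp hm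
  · linear_combination (norm := ring_nf) dy_011101 (thetaf τ) hodd h3 u v x γ h0 hp hm
  · linear_combination (norm := ring_nf) dy_011110 (thetaf τ) hodd h3 u v x γ h0 hp hm
  · linear_combination (norm := ring_nf) dy_100001 (thetaf τ) hodd h3 u v x γ h0 hp hm
  · linear_combination (norm := ring_nf) dy_100010 (thetaf τ) hodd h3 u v x γ h0 hp hm
  · linear_combination (norm := ring_nf) dy_100100 (thetaf τ) hodd h3 u v x γ h0 hp hm
  · linear_combination (norm := ring_nf) dy_101011 (thetaf τ) hodd h3 u v x γ h0 hp hm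
  · linear_combination (norm := ring_nf) dy_101101 (thetaf τ) hodd h3 u v x γ h0 hp hm
  · linear_combination (norm := ring_nf) dy_101110 (thetaf τ) hodd h3 u v x γ h0 hp hm
  · linear_combination (norm := ring_nf) dy_110011 (thetaf τ) hodd h3 u v x γ h0 hp hm
  · linear_combination (norm := ring_nf) dy_110101 (thetaf τ) hodd h3 u v x γ h0 hp hm
  · linear_combination (norm := ring_nf) dy_110110 (thetaf τ) hodd h3 u v x γ h0 hp hm
  · linear_combination (norm := ring_nf) dy_111111 (thetaf τ) hodd h3 u v x γ h0 hp hm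

/-- Total weight. -/
def wt {L : ℕ} (p : Fin L → Fin 2) : ℂ := ∑ k, eps (p k)

lemma wt_succ {L : ℕ} (p : Fin (L + 1) → Fin 2) : wt p = eps (p 0) + wt (Fin.tail p) := by
  simp [wt, Fin.sum_univ_succ, Fin.tail]

lemma wt_int {L : ℕ} (p : Fin L → Fin 2) : ∃ k : ℤ, wt p = k := by
  refine ⟨∑ k, if p k = 0 then 1 else -1, ?_⟩
  simp only [wt, eps]
  push_cast
  rfl

lemma sum_cons {L : ℕ} (F : (Fin (L + 1) → Fin 2) → ℂ) :
    ∑ r, F r = ∑ s : Fin 2, ∑ r : Fin L → Fin 2, F (Fin.cons s r) := by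
  rw [← Fintype.sum_prod_type' (f := fun (s : Fin 2) (r : Fin L → Fin 2) => F (Fin.cons s r))]
  exact (Fintype.sum_equiv (Fin.consEquiv (fun _ => Fin 2)) _ _ (fun x => rfl)).symm

/-- Embedding of operators on the last `L` sites. -/
def emb {L : ℕ} (M : Matrix (Fin 2 × (Fin L → Fin 2)) (Fin 2 × (Fin L → Fin 2)) ℂ) :
    Matrix (Fin 2 × (Fin (L + 1) → Fin 2)) (Fin 2 × (Fin (L + 1) → Fin 2)) ℂ :=
  fun p q => if p.2 0 = q.2 0 then M (p.1, Fin.tail p.2) (q.1, Fin.tail q.2) else 0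

lemma emb_one {L : ℕ} :
    emb (1 : Matrix (Fin 2 × (Fin L → Fin 2)) (Fin 2 × (Fin L → Fin 2)) ℂ) = 1 := by
  ext ⟨a, p⟩ ⟨b, q⟩
  obtain ⟨p0, p, rfl⟩ : ∃ x y, p = Fin.cons x y := ⟨p 0, Fin.tail p, (Fin.cons_self_tail p).symm⟩
  obtain ⟨q0, q, rfl⟩ : ∃ x y, q = Fin.cons x y := ⟨q 0, Fin.tail q, (Fin.cons_self_tail q).symm⟩
  simp only [emb, Matrix.one_apply, Prod.mk.injEq, Fin.cons_zero, Fin.tail_cons, Fin.cons_inj]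
  by_cases h : p0 = q0 <;> simp [h]

lemma emb_mul {L : ℕ} (M N : Matrix (Fin 2 × (Fin L → Fin 2)) (Fin 2 × (Fin L → Fin 2)) ℂ) :
    emb (M * N) = emb M * emb N := by
  ext ⟨a, p⟩ ⟨b, q⟩
  simp only [emb, Matrix.mul_apply, Fintype.sum_prod_type, sum_cons, Fin.cons_zero, Fin.tail_cons]
  by_cases h : p 0 = q 0
  · simp only [h, if_true]
    refine Finset.sum_congr rfl fun c _ => ?_
    rw [Finset.sum_eq_single (q 0)]
    · simp
    · intro s _ hs
      simp [hs]
    · simp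
  · simp only [h, if_false]
    symm
    refine Finset.sum_eq_zero fun c _ => Finset.sum_eq_zero fun s _ =>
      Finset.sum_eq_zero fun r _ => ?_
    by_cases h1 : p 0 = s
    · have : s ≠ q 0 := fun h2 => h (h1.trans h2)
      simp [this]
    · simp [h1]

lemma emb_prod {L : ℕ} (l : List (Matrix (Fin 2 × (Fin L → Fin 2)) (Fin 2 × (Fin L → Fin 2)) ℂ)) :
    (l.map emb).prod = emb l.prod := by
  induction l with
  | nil => simp [emb_one]
  | cons a l ih => simp [ih, emb_mul]

lemma RaiDyn_succ (τ γ : ℂ) {L : ℕ} (lam θ : ℂ) (i : Fin L) :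
    RaiDyn τ γ lam θ i.succ = emb (RaiDyn τ γ lam θ i) := by
  ext ⟨a, p⟩ ⟨b, q⟩
  have h1 : (∑ k ∈ Finset.univ.filter (fun k => i.succ < k), eps (q k)) =
      ∑ k ∈ Finset.univ.filter (fun k => i < k), eps (Fin.tail q k) := by
    simp [Finset.sum_filter, Fin.sum_univ_succ, Fin.tail]
  have h2 : (∀ k, k ≠ i.succ → p k = q k) ↔
      (p 0 = q 0 ∧ ∀ k, k ≠ i → Fin.tail p k = Fin.tail q k) := by
    rw [Fin.forall_fin_succ]
    simp [Fin.tail, (Fin.succ_ne_zero i).symm]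
  simp only [RaiDyn, emb, h1, h2]
  by_cases h : p 0 = q 0
  · by_cases h3 : ∀ k, k ≠ i → Fin.tail p k = Fin.tail q k
    · rw [if_pos ⟨h, h3⟩, if_pos h, if_pos h3]
      rfl
    · rw [if_neg (fun h4 => h3 h4.2), if_pos h, if_neg h3, mul_zero, mul_zero]
  · rw [if_neg (fun h4 => h h4.1), if_neg h, mul_zero]

lemma Tdyn_succ (τ γ : ℂ) {L : ℕ} (μ : Fin (L + 1) → ℂ) (lam θ : ℂ) (a b : Fin 2)
    (p q : Fin (L + 1) → Fin 2) :
    Tdyn τ γ μ lam θ (a, p) (b, q) =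
      ∑ c, Rdyn τ γ (lam - μ 0) (θ - γ * wt (Fin.tail p)) (a, p 0) (c, q 0) *
        Tdyn τ γ (Fin.tail μ) lam θ (c, Fin.tail p) (b, Fin.tail q) := by
  have h : Tdyn τ γ μ lam θ = RaiDyn τ γ (lam - μ 0) θ 0 * emb (Tdyn τ γ (Fin.tail μ) lam θ) := by
    rw [Tdyn, Tdyn, ← emb_prod, List.ofFn_succ, List.prod_cons, List.map_ofFn]
    congr 3
    ext i : 1
    simp [RaiDyn_succ, Fin.tail]
  rw [h, Matrix.mul_apply, Fintype.sum_prod_type]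
  refine Finset.sum_congr rfl fun c _ => ?_
  rw [sum_cons, Finset.sum_eq_single (q 0), Finset.sum_eq_single (Fin.tail p)]
  · have h1 : ∀ r : Fin L → Fin 2, (∑ k ∈ Finset.univ.filter (fun k => (0 : Fin (L + 1)) < k),
        eps ((Fin.cons (q 0) r : Fin (L + 1) → Fin 2) k)) = wt r := by
      intro r
      simp [Finset.sum_filter, Fin.sum_univ_succ, wt]
    have h2 : ∀ k, k ≠ 0 → p k = (Fin.cons (q 0) (Fin.tail p) : Fin (L + 1) → Fin 2) k := by
      intro k hk
      obtain ⟨j, rfl⟩ := Fin.exists_succ_eq.2 hk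
      simp [Fin.tail]
    simp only [RaiDyn, emb, h1, Fin.cons_zero, Fin.tail_cons, if_true]
    rw [if_pos h2, mul_one]
  · intro r _ hr
    have : ¬ ∀ k, k ≠ 0 → p k = (Fin.cons (q 0) r : Fin (L + 1) → Fin 2) k := by
      intro hk
      apply hr
      ext j : 1
      have := hk j.succ (Fin.succ_ne_zero j)
      simpa [Fin.tail] using this.symm
    simp only [RaiDyn]
    rw [if_neg this]
    simp
  · simp
  · intro s _ hs
    refine Finset.sum_eq_zero fun r _ => ?_
    simp [emb, hs]
  · simp

lemma Rdyn_weight (τ γ l x : ℂ) (a b c d : Fin 2) (h : eps a + eps b ≠ eps c + eps d) :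
    Rdyn τ γ l x (a, b) (c, d) = 0 := by
  simp only [Rdyn, Prod.mk.injEq]
  rw [if_neg, if_neg]
  · rintro ⟨rfl, rfl⟩
    exact h (add_comm _ _)
  · rintro ⟨rfl, rfl⟩
    exact h rfl

lemma Tdyn_weight (τ γ : ℂ) {L : ℕ} (μ : Fin L → ℂ) (lam θ : ℂ) (a b : Fin 2)
    (p q : Fin L → Fin 2) (h : eps a + wt p ≠ eps b + wt q) :
    Tdyn τ γ μ lam θ (a, p) (b, q) = 0 := by
  induction L generalizing a b with
  | zero =>
    have hpq : p = q := Subsingleton.elim _ _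
    subst hpq
    have : a ≠ b := by rintro rfl; exact h rfl
    simp [Tdyn, this]
  | succ L ih =>
    rw [Tdyn_succ]
    refine Finset.sum_eq_zero fun c _ => ?_
    by_cases h1 : eps a + eps (p 0) = eps c + eps (q 0)
    · rw [ih, mul_zero]
      intro h2
      apply h
      rw [wt_succ, wt_succ]
      linear_combination h1 + h2
    · rw [Rdyn_weight _ _ _ _ _ _ _ _ h1, zero_mul]

/-- Product of two monodromy matrices. -/
def TT (τ γ : ℂ) {L : ℕ} (μ : Fin L → ℂ) (l1 l2 θ : ℂ) (i j c d : Fin 2)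
    (p q : Fin L → Fin 2) : ℂ :=
  ∑ r, Tdyn τ γ μ l1 θ (i, p) (c, r) * Tdyn τ γ μ l2 (θ - γ * eps c) (j, r) (d, q)

lemma TT_succ (τ γ : ℂ) {L : ℕ} (μ : Fin (L + 1) → ℂ) (l1 l2 θ : ℂ) (i j c d : Fin 2)
    (p q : Fin (L + 1) → Fin 2) :
    TT τ γ μ l1 l2 θ i j c d p q = ∑ e, ∑ g, ∑ s,
      Rdyn τ γ (l1 - μ 0) (θ - γ * wt (Fin.tail p)) (i, p 0) (e, s) *
      Rdyn τ γ (l2 - μ 0) (θ - γ * wt (Fin.tail p) - γ * eps e) (j, s) (g, q 0) *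
      TT τ γ (Fin.tail μ) l1 l2 θ e g c d (Fin.tail p) (Fin.tail q) := by
  have key : ∀ (e g s : Fin 2) (r : Fin L → Fin 2),
      Rdyn τ γ (l1 - μ 0) (θ - γ * wt (Fin.tail p)) (i, p 0) (e, s) *
        Tdyn τ γ (Fin.tail μ) l1 θ (e, Fin.tail p) (c, r) *
      (Rdyn τ γ (l2 - μ 0) (θ - γ * eps c - γ * wt r) (j, s) (g, q 0) *
        Tdyn τ γ (Fin.tail μ) l2 (θ - γ * eps c) (g, r) (d, Fin.tail q)) =
      Rdyn τ γ (l1 - μ 0) (θ - γ * wt (Fin.tail p)) (i, p 0) (e, s) *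
      Rdyn τ γ (l2 - μ 0) (θ - γ * wt (Fin.tail p) - γ * eps e) (j, s) (g, q 0) *
      (Tdyn τ γ (Fin.tail μ) l1 θ (e, Fin.tail p) (c, r) *
        Tdyn τ γ (Fin.tail μ) l2 (θ - γ * eps c) (g, r) (d, Fin.tail q)) := by
    intro e g s r
    by_cases h : eps e + wt (Fin.tail p) = eps c + wt r
    · rw [show θ - γ * eps c - γ * wt r = θ - γ * wt (Fin.tail p) - γ * eps e by
        linear_combination γ * h]
      ring
    · rw [Tdyn_weight _ _ _ _ _ _ _ _ _ h]
      ring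
  simp only [TT, sum_cons, Tdyn_succ τ γ μ, Fin.tail_cons, Fin.cons_zero, Finset.sum_mul_sum]
  simp only [key]
  simp only [Finset.mul_sum]
  refine (Finset.sum_congr rfl fun s _ => Finset.sum_comm).trans ?_
  refine Finset.sum_comm.trans ?_
  refine Finset.sum_congr rfl fun e _ => ?_
  refine (Finset.sum_congr rfl fun s _ => Finset.sum_comm).trans ?_
  exact Finset.sum_comm

lemma RTT {τ : ℂ} (hτ : 0 < τ.im) (γ : ℂ) {L : ℕ} (μ : Fin L → ℂ) (l1 l2 θ : ℂ)
    (hgen : ∀ k : ℤ, thetaf τ (θ + γ * k) ≠ 0) (a b c d : Fin 2) (p q : Fin L → Fin 2) :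
    ∑ i, ∑ j, Rdyn τ γ (l1 - l2) (θ - γ * wt p) (a, b) (i, j) * TT τ γ μ l1 l2 θ i j c d p q =
    ∑ i, ∑ j, TT τ γ μ l2 l1 θ b a j i p q * Rdyn τ γ (l1 - l2) θ (i, j) (c, d) := by
  induction L generalizing a b with
  | zero =>
    have hpq : p = q := Subsingleton.elim _ _
    subst hpq
    have hw : wt p = 0 := by simp [wt]
    simp only [TT, Tdyn, List.ofFn_zero, List.prod_nil, Matrix.one_apply, Prod.mk.injEq,
      Fintype.sum_unique, hw, mul_zero, sub_zero]
    have : ∀ r : Fin 0 → Fin 2, (p = r) = True := fun r => by simp [Subsingleton.elim p r]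
    have h' : ∀ r : Fin 0 → Fin 2, (r = p) = True := fun r => by simp [Subsingleton.elim p r]
    simp only [this, h', and_true]
    fin_cases a <;> fin_cases b <;> fin_cases c <;> fin_cases d <;> simp [Fin.sum_univ_two]
  | succ L ih =>
    obtain ⟨k, hk⟩ := wt_int (Fin.tail p)
    set x := θ - γ * wt (Fin.tail p) with hx
    have h0 : thetaf τ x ≠ 0 := by
      have := hgen (-k); push_cast at this; rwa [hx, hk, sub_eq_add_neg, ← mul_neg]
    have hp : thetaf τ (x + γ) ≠ 0 := by
      have := hgen (-k + 1); push_cast at this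
      rwa [hx, hk, show θ - γ * k + γ = θ + γ * (-k + 1) by ring]
    have hm : thetaf τ (x - γ) ≠ 0 := by
      have := hgen (-k - 1); push_cast at this
      rwa [hx, hk, show θ - γ * k - γ = θ + γ * (-k - 1) by ring]
    have D := fun e g => dybe hτ γ (l1 - l2) (l2 - μ 0) x h0 hp hm a b (p 0) e g (q 0)
    have I := fun e g => ih (Fin.tail μ) e g (Fin.tail p) (Fin.tail q)
    simp only [TT_succ τ γ μ, ← hx] at I ⊢
    rw [show θ - γ * wt p = x - γ * eps (p 0) by rw [hx, wt_succ]; ring]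
    rw [show l1 - l2 + (l2 - μ 0) = l1 - μ 0 by ring] at D
    simp only [Fin.sum_univ_two] at D I ⊢
    generalize hX : TT τ γ (Fin.tail μ) l1 l2 θ = X at D I ⊢
    generalize hY : TT τ γ (Fin.tail μ) l2 l1 θ = Y at D I ⊢
    generalize Fin.tail p = tp at D I ⊢
    generalize Fin.tail q = tq at D I ⊢
    generalize p 0 = p0 at D I ⊢
    generalize q 0 = q0 at D I ⊢
    generalize Rdyn τ γ (l1 - l2) = R12 at D I ⊢
    generalize Rdyn τ γ (l1 - μ 0) = R1 at D I ⊢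
    generalize Rdyn τ γ (l2 - μ 0) = R2 at D I ⊢
    linear_combination X 0 0 c d tp tq * D 0 0 + X 0 1 c d tp tq * D 0 1
      + X 1 0 c d tp tq * D 1 0 + X 1 1 c d tp tq * D 1 1
      + R2 x (b, p0) (0, 0) * R1 (x - γ * eps 0) (a, 0) (0, q0) * I 0 0
      + R2 x (b, p0) (0, 1) * R1 (x - γ * eps 0) (a, 1) (0, q0) * I 0 0
      + R2 x (b, p0) (0, 0) * R1 (x - γ * eps 0) (a, 0) (1, q0) * I 1 0
      + R2 x (b, p0) (0, 1) * R1 (x - γ * eps 0) (a, 1) (1, q0) * I 1 0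
      + R2 x (b, p0) (1, 0) * R1 (x - γ * eps 1) (a, 0) (0, q0) * I 0 1
      + R2 x (b, p0) (1, 1) * R1 (x - γ * eps 1) (a, 1) (0, q0) * I 0 1
      + R2 x (b, p0) (1, 0) * R1 (x - γ * eps 1) (a, 0) (1, q0) * I 1 1
      + R2 x (b, p0) (1, 1) * R1 (x - γ * eps 1) (a, 1) (1, q0) * I 1 1

lemma Rdyn_continuous {τ : ℂ} (hτ : 0 < τ.im) (γ m x : ℂ) (P Q : Fin 2 × Fin 2) :
    Continuous fun l => Rdyn τ γ (l - m) x P Q := by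
  have hc := (thetaf_differentiable hτ).continuous
  unfold Rdyn
  split_ifs <;> fun_prop

lemma Tdyn_continuous {τ : ℂ} (hτ : 0 < τ.im) (γ θ : ℂ) {L : ℕ} (μ : Fin L → ℂ) (a b : Fin 2)
    (p q : Fin L → Fin 2) : Continuous fun l => Tdyn τ γ μ l θ (a, p) (b, q) := by
  induction L generalizing a b with
  | zero => simp only [Tdyn, List.ofFn_zero]; exact continuous_const
  | succ L ih =>
    simp only [Tdyn_succ]
    exact continuous_finsetSum _ fun c _ => (Rdyn_continuous hτ _ _ _ _ _).mul (ih _ _ _ _ _)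

/-- Commutation rule for the dynamical creation operators:
`ℬ(λ₁, θ) ℬ(λ₂, θ+γ) = ℬ(λ₂, θ) ℬ(λ₁, θ+γ)`. -/
theorem dynamical_BB_commutation (τ γ : ℂ) (hτ : 0 < τ.im)
    (L : ℕ) (hL : 1 ≤ L) (μ : Fin L → ℂ) (l1 l2 θ : ℂ)
    (hgen : ∀ k : ℤ, thetaf τ (θ + γ * k) ≠ 0) :
    Bdyn τ γ μ l1 θ * Bdyn τ γ μ l2 (θ + γ) =
      Bdyn τ γ μ l2 θ * Bdyn τ γ μ l1 (θ + γ) := by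

  ext p q
  have hc : Dense {l : ℂ | thetaf τ (l - (l2 - γ)) ≠ 0} := thetaf_dense hτ (hgen 0) _
  have hB : ∀ l l' : ℂ, (Bdyn τ γ μ l θ * Bdyn τ γ μ l' (θ + γ)) p q =
      TT τ γ μ l l' θ 0 0 1 1 p q := by
    intro l l'
    rw [Matrix.mul_apply, TT, show θ - γ * eps 1 = θ + γ by simp [eps]]
    rfl
  have c1 : Continuous fun l => (Bdyn τ γ μ l θ * Bdyn τ γ μ l2 (θ + γ)) p q := by
    simp only [Matrix.mul_apply, Bdyn]
    exact continuous_finsetSum _ fun r _ => (Tdyn_continuous hτ _ _ _ _ _ _ _).mul continuous_const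
  have c2 : Continuous fun l => (Bdyn τ γ μ l2 θ * Bdyn τ γ μ l (θ + γ)) p q := by
    simp only [Matrix.mul_apply, Bdyn]
    exact continuous_finsetSum _ fun r _ => continuous_const.mul (Tdyn_continuous hτ _ _ _ _ _ _ _)
  refine congrFun (Continuous.ext_on hc c1 c2 ?_) l1
  intro l hl
  have hl' : thetaf τ (l - l2 + γ) ≠ 0 := by
    rwa [show l - l2 + γ = l - (l2 - γ) by ring]
  have h := RTT hτ γ μ l l2 θ hgen 0 0 1 1 p q
  simp [Fin.sum_univ_two, Rdyn] at h
  simp only [hB]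
  rw [mul_comm] at h
  grind

end
end
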